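/- arXiv:2311.03013 — 2 statements merged into one kernel-verified Lean document; each statement's English description precedes it below -/
import Mathlib

section
/- Let S ∈ L¹_loc[0,∞) be log-linearly slowly decreasing, with Laplace transform 𝓛{S;s} = ∫₀^∞ e^{−sx} S(x) dx convergent for every complex s with Re s > 1, and set U(s) = Re 𝓛{S;s}. Assume U has L¹_loc-boundary behavior on 1 + i(ℝ∖{0}), and assume there exist λ > 0 and c ≥ 0 such that U(σ+it) ≥ −c for all t ∈ (−λ,λ) and all σ ∈ (1,2]. Then the limit a = lim_{σ→1⁺} (σ−1) U(σ) exists and S(x) ∼ a e^x as x → ∞, i.e. lim_{x→∞} e^{−x} S(x) = a. -/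
open MeasureTheory Filter Set

/-- The Laplace transform `𝓛{S;s} = ∫₀^∞ e^{-sx} S(x) dx`. -/
noncomputable def laplaceT (S : ℝ → ℝ) (s : ℂ) : ℂ :=
  ∫ x in Ioi (0 : ℝ), Complex.exp (-s * x) * (S x : ℂ)

/-- `S` is log-linearly slowly decreasing. -/
def LogLinSlowlyDecreasing (S : ℝ → ℝ) : Prop :=
  ∀ ε : ℝ, 0 < ε → ∃ h : ℝ, 0 < h ∧ ∃ x₀ : ℝ, 0 < x₀ ∧ ∀ x y : ℝ,
    x₀ ≤ x → x ≤ y → y ≤ x + h → (S y - S x) / Real.exp x ≥ -ε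

/-- `U` (defined on `Re s > 1`) has `L¹_loc`-boundary behavior on `1 + i(ℝ∖{0})`. -/
def L1locBoundaryBehavior (U : ℂ → ℝ) : Prop :=
  ∃ f : ℝ → ℝ, ∀ a b : ℝ, a ≤ b → (0 : ℝ) ∉ Icc a b →
    IntegrableOn f (Icc a b) ∧
    Tendsto (fun σ : ℝ => ∫ t in a..b, |U (σ + t * Complex.I) - f t|)
      (nhdsWithin 1 (Ioi 1)) (nhds 0)


open Topology

/-- cosine transform of `h` -/
noncomputable def cosT (h : ℝ → ℝ) (t : ℝ) : ℝ := ∫ x, h x * Real.cos (t * x)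

/-- damped cosine transform -/
noncomputable def uu (g : ℝ → ℝ) (η t : ℝ) : ℝ :=
  cosT (fun x => Real.exp (-(η * x)) * g x) t

lemma cosT_integrable {h : ℝ → ℝ} (hh : Integrable h) (t : ℝ) :
    Integrable (fun x => h x * Real.cos (t * x)) := by
  refine hh.mul_bdd (c := 1) ?_ ?_
  · exact (by fun_prop : Continuous fun x : ℝ => Real.cos (t * x)).aestronglyMeasurable
  · exact Eventually.of_forall fun x => by simpa using Real.abs_cos_le_one _

lemma cosT_continuous {h : ℝ → ℝ} (hh : Integrable h) : Continuous (cosT h) := by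
  unfold cosT
  refine continuous_of_dominated (bound := fun x => |h x|) ?_ ?_ hh.abs ?_
  · exact fun t => (cosT_integrable hh t).aestronglyMeasurable
  · intro t
    refine Eventually.of_forall fun x => ?_
    rw [Real.norm_eq_abs, abs_mul]
    exact mul_le_of_le_one_right (abs_nonneg _) (Real.abs_cos_le_one _)
  · exact Eventually.of_forall fun x => by fun_prop

lemma cosT_fubini {h : ℝ → ℝ} (hh : Integrable h) {ψ : ℝ → ℝ} (hψ : Continuous ψ) (T : ℝ) :
    ∫ t in (0:ℝ)..T, ψ t * cosT h t
      = ∫ x, h x * ∫ t in (0:ℝ)..T, ψ t * Real.cos (t * x) := by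
  have h1 : Integrable (fun p : ℝ × ℝ => ψ p.1 * h p.2)
      ((volume.restrict (uIoc 0 T)).prod volume) :=
    Integrable.mul_prod (f := ψ) (g := h)
      (hψ.integrableOn_uIoc) hh
  have h2 : Integrable (Function.uncurry fun t x => ψ t * h x * Real.cos (t * x))
      ((volume.restrict (uIoc 0 T)).prod volume) := by
    refine h1.mul_bdd (c := 1) ?_ ?_
    · exact (by fun_prop : Continuous fun p : ℝ × ℝ => Real.cos (p.1 * p.2)).aestronglyMeasurable
    · exact Eventually.of_forall fun x => by simpa using Real.abs_cos_le_one _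
  have h3 := intervalIntegral_integral_swap (μ := volume) (a := 0) (b := T) h2
  have e1 : ∀ t, ψ t * cosT h t = ∫ x, ψ t * h x * Real.cos (t * x) := by
    intro t
    unfold cosT
    rw [← integral_const_mul]
    congr 1; ext x; ring
  have e2 : ∀ x, (h x * ∫ t in (0:ℝ)..T, ψ t * Real.cos (t * x))
      = ∫ t in (0:ℝ)..T, ψ t * h x * Real.cos (t * x) := by
    intro x
    rw [← intervalIntegral.integral_const_mul]
    congr 1; ext t; ring
  simp_rw [e1, e2]
  exact h3

lemma laplace_deriv {h : ℝ → ℝ} (hi : ∀ η > 0, Integrable (fun x => Real.exp (-(η * x)) * h x))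
    (h0 : ∀ x < 0, h x = 0) {η : ℝ} (hη : 0 < η) :
    Integrable (fun x => Real.exp (-(η * x)) * (x * h x)) ∧
    HasDerivAt (fun η => ∫ x, Real.exp (-(η * x)) * h x)
      (-∫ x, Real.exp (-(η * x)) * (x * h x)) η := by
  have key := hasDerivAt_integral_of_dominated_loc_of_deriv_le (μ := volume)
    (F := fun η x => Real.exp (-(η * x)) * h x)
    (F' := fun η x => -(Real.exp (-(η * x)) * (x * h x))) (x₀ := η) (s := Ioi (η/2))
    (bound := fun x => (4/η) * |Real.exp (-((η/4) * x)) * h x|) (Ioi_mem_nhds (by linarith))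
    ?_ (hi η hη) ?_ ?_ ?_ ?_
  · obtain ⟨k1, k2⟩ := key
    refine ⟨by simpa using k1.neg, ?_⟩
    rw [integral_neg] at k2
    exact k2
  · filter_upwards [Ioi_mem_nhds hη] with a ha
    exact (hi a ha).aestronglyMeasurable
  · have := (hi η hη).aestronglyMeasurable
    have h2 := ((continuous_id.aestronglyMeasurable (μ := (volume : Measure ℝ))).mul this).neg
    refine h2.congr (Eventually.of_forall fun x => ?_)
    simp; ring
  · refine Eventually.of_forall fun x a ha => ?_
    have ha : η/2 < a := ha
    rcases lt_or_ge x 0 with hx | hx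
    · simp [h0 x hx]
    · rw [norm_neg, Real.norm_eq_abs, abs_mul, abs_mul, abs_mul, Real.abs_exp, Real.abs_exp,
        abs_of_nonneg hx]
      have e1 : Real.exp (-(a*x)) ≤ Real.exp (-((η/4) * x)) * Real.exp (-((η/4) * x)) := by
        rw [← Real.exp_add]
        apply Real.exp_le_exp.mpr; nlinarith
      have e2 : Real.exp (-((η/4)*x)) * x ≤ 4/η := by
        rw [Real.exp_neg, inv_mul_eq_div, div_le_div_iff₀ (Real.exp_pos _) hη]
        have := Real.add_one_le_exp ((η/4)*x)
        nlinarith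
      have e3 := Real.exp_pos (-((η/4) * x))
      calc Real.exp (-(a*x)) * (x * |h x|)
          ≤ Real.exp (-((η/4) * x)) * Real.exp (-((η/4) * x)) * (x * |h x|) := by
            apply mul_le_mul_of_nonneg_right e1; positivity
        _ = (Real.exp (-((η/4)*x)) * x) * (Real.exp (-((η/4) * x)) * |h x|) := by ring
        _ ≤ _ := by apply mul_le_mul_of_nonneg_right e2; positivity
  · exact ((hi (η/4) (by linarith)).abs).const_mul _
  · refine Eventually.of_forall fun x a ha => ?_
    have : HasDerivAt (fun a => Real.exp (-(a * x))) (Real.exp (-(a*x)) * (-(1*x))) a :=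
      (((hasDerivAt_id a).mul_const x).neg).exp
    refine (this.mul_const (h x)).congr_deriv ?_
    ring

lemma ode_bound {F F1 F2 : ℝ → ℝ} {k : ℝ} (hk : 0 < k) (d1 : ∀ η > 0, HasDerivAt F (F1 η) η)
    (d2 : ∀ η > 0, HasDerivAt F1 (F2 η) η) (hle : ∀ η ∈ Ioc (0:ℝ) 1, F2 η ≤ k^2 * F η) :
    ∃ C, ∀ η ∈ Ioc (0:ℝ) 1, F η ≤ C := by
  set D : ℝ → ℝ := fun η => Real.exp (-(k*η)) * (F1 η + k * F η) with hD
  have dD : ∀ η > 0, HasDerivAt D (Real.exp (-(k*η)) * (F2 η - k^2 * F η)) η := by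
    intro η hη
    have e : HasDerivAt (fun a => Real.exp (-(k * a))) (Real.exp (-(k*η)) * (-(k*1))) η :=
      (((hasDerivAt_id η).const_mul k).neg).exp
    refine (e.mul ((d2 η hη).add ((d1 η hη).const_mul k))).congr_deriv ?_
    simp only [Pi.add_apply]; ring
  have aD : AntitoneOn D (Ioc 0 1) := by
    refine antitoneOn_of_deriv_nonpos (convex_Ioc 0 1)
      (fun x hx => (dD x hx.1).continuousAt.continuousWithinAt) ?_ ?_
    · intro x hx
      rw [interior_Ioc] at hx
      exact (dD x hx.1).differentiableAt.differentiableWithinAt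
    · intro x hx
      rw [interior_Ioc] at hx
      rw [(dD x hx.1).deriv]
      have := hle x ⟨hx.1, hx.2.le⟩
      have := Real.exp_pos (-(k*x))
      nlinarith
  set Q := Real.exp (2*k) * |D 1| with hQ
  set E : ℝ → ℝ := fun η => Real.exp (k*η) * F η + Q * η with hE
  have dE : ∀ η > 0, HasDerivAt E (Real.exp (2*k*η) * D η + Q) η := by
    intro η hη
    have e : HasDerivAt (fun a => Real.exp (k * a)) (Real.exp (k*η) * (k*1)) η :=
      ((hasDerivAt_id η).const_mul k).exp
    refine ((e.mul (d1 η hη)).add ((hasDerivAt_id η).const_mul Q)).congr_deriv ?_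
    have : Real.exp (2*k*η) * Real.exp (-(k*η)) = Real.exp (k*η) := by
      rw [← Real.exp_add]; ring_nf
    simp only [hD]
    linear_combination -(F1 η + k * F η) * this
  have mE : MonotoneOn E (Ioc 0 1) := by
    refine monotoneOn_of_deriv_nonneg (convex_Ioc 0 1)
      (fun x hx => (dE x hx.1).continuousAt.continuousWithinAt) ?_ ?_
    · intro x hx
      rw [interior_Ioc] at hx
      exact (dE x hx.1).differentiableAt.differentiableWithinAt
    · intro x hx
      rw [interior_Ioc] at hx
      rw [(dE x hx.1).deriv]
      have h1 : D 1 ≤ D x := aD ⟨hx.1, hx.2.le⟩ ⟨one_pos, le_rfl⟩ hx.2.le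
      have h2 : -|D 1| ≤ D x := (neg_abs_le _).trans h1
      have h3 : Real.exp (2*k*x) ≤ Real.exp (2*k) := Real.exp_le_exp.mpr (by nlinarith [hx.2])
      have h4 := Real.exp_pos (2*k*x)
      nlinarith [abs_nonneg (D 1)]
  refine ⟨|E 1|, fun η hη => ?_⟩
  have h1 : E η ≤ E 1 := mE hη ⟨one_pos, le_rfl⟩ hη.2
  have hQ0 : 0 ≤ Q := by positivity
  have h2 : Real.exp (k*η) * F η ≤ |E 1| := by
    have : 0 ≤ Q * η := mul_nonneg hQ0 hη.1.le
    have : Real.exp (k*η) * F η ≤ E η := by simp only [hE]; linarith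
    exact this.trans (h1.trans (le_abs_self _))
  have h3 : 1 ≤ Real.exp (k*η) := Real.one_le_exp (mul_nonneg hk.le hη.1.le)
  by_contra hcon
  push Not at hcon
  have : 0 ≤ |E 1| := abs_nonneg _
  nlinarith

lemma hann_identity {r k : ℝ} (hk : k * r = Real.pi) (x : ℝ) :
    x^2 * (∫ t in (0:ℝ)..r, (1 + Real.cos (k*t)) * Real.cos (t*x)) =
    k^2 * (∫ t in (0:ℝ)..r, (1 + Real.cos (k*t)) * Real.cos (t*x))
      - k^2 * ∫ t in (0:ℝ)..r, 1 * Real.cos (t*x) := by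
  have hW : ∀ t : ℝ, HasDerivAt (fun t => -(k * Real.sin (k*t)) * Real.cos (t*x)
      + x * ((1 + Real.cos (k*t)) * Real.sin (t*x)))
      (x^2 * ((1 + Real.cos (k*t)) * Real.cos (t*x)) - (k^2 * ((1 + Real.cos (k*t)) * Real.cos (t*x))
        - k^2 * (1 * Real.cos (t*x)))) t := by
    intro t
    have a1 : HasDerivAt (fun t => Real.sin (k*t)) (Real.cos (k*t) * (k*1)) t :=
      ((hasDerivAt_id t).const_mul k).sin
    have a2 : HasDerivAt (fun t => Real.cos (k*t)) (-Real.sin (k*t) * (k*1)) t :=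
      ((hasDerivAt_id t).const_mul k).cos
    have b1 : HasDerivAt (fun t => Real.sin (t*x)) (Real.cos (t*x) * (1*x)) t :=
      ((hasDerivAt_id t).mul_const x).sin
    have b2 : HasDerivAt (fun t => Real.cos (t*x)) (-Real.sin (t*x) * (1*x)) t :=
      ((hasDerivAt_id t).mul_const x).cos
    refine ((((a1.const_mul k).neg).mul b2).add (((a2.const_add 1).mul b1).const_mul x)).congr_deriv ?_
    simp only [Pi.neg_apply]; ring
  have hIntg : ∀ ψ : ℝ → ℝ, Continuous ψ → IntervalIntegrable ψ volume 0 r :=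
    fun ψ hψ => hψ.intervalIntegrable _ _
  have := intervalIntegral.integral_eq_sub_of_hasDerivAt (a := 0) (b := r) (fun t _ => hW t)
    (hIntg _ (by fun_prop))
  rw [intervalIntegral.integral_sub (hIntg _ (by fun_prop)) (hIntg _ (by fun_prop)),
    intervalIntegral.integral_sub (hIntg _ (by fun_prop)) (hIntg _ (by fun_prop)),
    intervalIntegral.integral_const_mul, intervalIntegral.integral_const_mul,
    intervalIntegral.integral_const_mul] at this
  simp [hk] at this
  simp
  linarith

lemma mass_bound {g : ℝ → ℝ} (hi : ∀ η > 0, Integrable (fun x => Real.exp (-(η * x)) * g x))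
    (h0 : ∀ x < 0, g x = 0) {r c : ℝ} (hr : 0 < r)
    (hlow : ∀ t ∈ Icc 0 r, ∀ η ∈ Ioc (0:ℝ) 1, -c ≤ uu g η t) :
    ∃ C, ∀ η ∈ Ioc (0:ℝ) 1, ∫ t in (0:ℝ)..(r/2), |uu g η t| ≤ C := by
  set k := Real.pi / r with hkdef
  have hk : k * r = Real.pi := by rw [hkdef]; field_simp
  have hk0 : 0 < k := by positivity
  set m : ℝ → ℝ := fun x => ∫ t in (0:ℝ)..r, (1 + Real.cos (k*t)) * Real.cos (t*x) with hm
  have mcont : Continuous m := by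
    rw [hm]
    apply intervalIntegral.continuous_parametric_intervalIntegral_of_continuous'
    fun_prop
  have mbd : ∀ x, ‖m x‖ ≤ 2 * |r - 0| := by
    intro x
    apply intervalIntegral.norm_integral_le_of_norm_le_const
    intro t _
    rw [Real.norm_eq_abs, abs_mul]
    have := Real.abs_cos_le_one (k*t)
    have h2 := Real.abs_cos_le_one (t*x)
    have h3 : |1 + Real.cos (k*t)| ≤ 2 := by
      rw [abs_le] at *; constructor <;> linarith
    calc _ ≤ 2 * 1 := mul_le_mul h3 h2 (abs_nonneg _) (by norm_num)
      _ = 2 := by norm_num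
  have i0 : ∀ η > 0, Integrable (fun x => Real.exp (-(η * x)) * (g x * m x)) := by
    intro η hη
    have := (hi η hη).mul_bdd (c := 2 * |r-0|) mcont.aestronglyMeasurable
      (Eventually.of_forall mbd)
    refine this.congr (Eventually.of_forall fun x => ?_)
    simp; ring
  have i1 : ∀ η > 0, Integrable (fun x => Real.exp (-(η * x)) * (x * (g x * m x))) :=
    fun η hη => (laplace_deriv i0 (fun x hx => by simp [h0 x hx]) hη).1
  have i2 : ∀ η > 0, Integrable (fun x => Real.exp (-(η * x)) * (x * (x * (g x * m x)))) :=
    fun η hη => (laplace_deriv i1 (fun x hx => by simp [h0 x hx]) hη).1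
  set F : ℝ → ℝ := fun η => ∫ x, Real.exp (-(η * x)) * (g x * m x) with hF
  have hucont : ∀ η > 0, Continuous (uu g η) := fun η hη => cosT_continuous (hi η hη)
  have fub : ∀ η > 0, F η = ∫ t in (0:ℝ)..r, (1 + Real.cos (k*t)) * uu g η t := by
    intro η hη
    have := cosT_fubini (hi η hη) (ψ := fun t => 1 + Real.cos (k*t)) (by fun_prop) r
    unfold uu
    rw [this, hF]
    simp only [hm]
    congr 1; ext x; ring
  have fub2 : ∀ η > 0, (∫ x, Real.exp (-(η * x)) * (x * (x * (g x * m x))))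
      = k^2 * F η - k^2 * ∫ t in (0:ℝ)..r, uu g η t := by
    intro η hη
    have := cosT_fubini (hi η hη) (ψ := fun t => 1) (by fun_prop) r
    have e : (∫ t in (0:ℝ)..r, uu g η t) = ∫ x, Real.exp (-(η * x)) * g x *
        ∫ t in (0:ℝ)..r, 1 * Real.cos (t*x) := by
      rw [← this]; simp [uu]
    have ii : Integrable fun x => k^2 * (Real.exp (-(η * x)) * g x *
        ∫ t in (0:ℝ)..r, 1 * Real.cos (t*x)) := by
      refine (((i0 η hη).const_mul (k^2)).sub (i2 η hη)).congr (Eventually.of_forall fun x => ?_)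
      have := hann_identity hk x
      have h' : k^2 * (∫ t in (0:ℝ)..r, 1 * Real.cos (t*x)) = k^2 * m x - x^2 * m x := by
        simp only [hm]; linarith
      have : k^2 * (Real.exp (-(η * x)) * g x * ∫ t in (0:ℝ)..r, 1 * Real.cos (t*x)) =
        (Real.exp (-(η * x)) * g x) * (k^2 * (∫ t in (0:ℝ)..r, 1 * Real.cos (t*x))) := by ring
      simp only [Pi.sub_apply]
      rw [this, h']; ring
    rw [e, hF, ← integral_const_mul, ← integral_const_mul,
      ← integral_sub ((i0 η hη).const_mul _) ii]
    congr 1; ext x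
    have := hann_identity hk x
    have h' : k^2 * (∫ t in (0:ℝ)..r, 1 * Real.cos (t*x)) = k^2 * m x - x^2 * m x := by
      simp only [hm]; linarith
    have : k^2 * (Real.exp (-(η * x)) * g x * ∫ t in (0:ℝ)..r, 1 * Real.cos (t*x)) =
      (Real.exp (-(η * x)) * g x) * (k^2 * (∫ t in (0:ℝ)..r, 1 * Real.cos (t*x))) := by ring
    rw [this, h']; ring
  obtain ⟨C, hC⟩ := ode_bound (F := fun η => F η + r * c)
    (F1 := fun η => -∫ x, Real.exp (-(η * x)) * (x * (g x * m x)))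
    (F2 := fun η => ∫ x, Real.exp (-(η * x)) * (x * (x * (g x * m x)))) hk0
    (fun η hη => ((laplace_deriv i0 (fun x hx => by simp [h0 x hx]) hη).2.add_const _))
    (fun η hη => ((laplace_deriv i1 (fun x hx => by simp [h0 x hx]) hη).2.neg).congr_deriv
      (neg_neg _)) (by
    intro η hη
    rw [fub2 η hη.1]
    have : ∫ t in (0:ℝ)..r, (-c) ≤ ∫ t in (0:ℝ)..r, uu g η t := by
      apply intervalIntegral.integral_mono_on hr.le (by simp)
        ((hucont η hη.1).intervalIntegrable _ _)
      intro t ht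
      exact hlow t ht η hη
    simp at this
    have hk2 : 0 < k^2 := by positivity
    nlinarith)
  have hcint : ∫ t in (0:ℝ)..r, (1 + Real.cos (k*t)) * c = r * c := by
    rw [intervalIntegral.integral_mul_const, intervalIntegral.integral_add (by simp)
      ((by fun_prop : Continuous fun t => Real.cos (k*t)).intervalIntegrable _ _)]
    rw [intervalIntegral.integral_comp_mul_left (fun t => Real.cos t) hk0.ne']
    simp [hk]
  refine ⟨C + |c| * (r/2), fun η hη => ?_⟩
  have hu := hucont η hη.1
  have s1 : ∫ t in (0:ℝ)..r, (1 + Real.cos (k*t)) * (uu g η t + c) = F η + r * c := by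
    rw [fub η hη.1, ← hcint, ← intervalIntegral.integral_add]
    · congr 1; ext t; ring
    · exact (by fun_prop : Continuous _).intervalIntegrable _ _
    · exact (by fun_prop : Continuous _).intervalIntegrable _ _
  have s2 : ∫ t in (0:ℝ)..(r/2), (uu g η t + c) ≤
      ∫ t in (0:ℝ)..(r/2), (1 + Real.cos (k*t)) * (uu g η t + c) := by
    apply intervalIntegral.integral_mono_on (by linarith)
    · exact (by fun_prop : Continuous _).intervalIntegrable _ _
    · exact (by fun_prop : Continuous _).intervalIntegrable _ _
    · intro t ht
      have : 0 ≤ Real.cos (k*t) := by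
        apply Real.cos_nonneg_of_neg_pi_div_two_le_of_le
        · have := mul_nonneg hk0.le ht.1
          linarith [Real.pi_pos]
        · have := mul_le_mul_of_nonneg_left ht.2 hk0.le
          nlinarith
      have := hlow t ⟨ht.1, by linarith [ht.2]⟩ η hη
      nlinarith
  have s3 : ∫ t in (0:ℝ)..(r/2), (1 + Real.cos (k*t)) * (uu g η t + c) ≤
      ∫ t in (0:ℝ)..r, (1 + Real.cos (k*t)) * (uu g η t + c) := by
    apply intervalIntegral.integral_mono_interval le_rfl (by linarith) (by linarith)
    · rw [EventuallyLE, ae_restrict_iff' measurableSet_Ioc]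
      refine Eventually.of_forall fun t ht => ?_
      have := hlow t ⟨ht.1.le, ht.2⟩ η hη
      have h2 := Real.neg_one_le_cos (k*t)
      apply mul_nonneg <;> linarith
    · exact (by fun_prop : Continuous _).intervalIntegrable _ _
  have s4 : ∫ t in (0:ℝ)..(r/2), |uu g η t| ≤ ∫ t in (0:ℝ)..(r/2), ((uu g η t + c) + |c|) := by
    apply intervalIntegral.integral_mono_on (by linarith)
    · exact (by fun_prop : Continuous _).intervalIntegrable _ _
    · exact (by fun_prop : Continuous _).intervalIntegrable _ _
    · intro t ht
      have h1 := hlow t ⟨ht.1, by linarith [ht.2]⟩ η hη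
      have : |uu g η t + c + -c| ≤ |uu g η t + c| + |-c| := abs_add_le _ _
      rw [abs_neg, abs_of_nonneg (by linarith : 0 ≤ uu g η t + c)] at this
      simpa using this
  rw [intervalIntegral.integral_add ((by fun_prop : Continuous _).intervalIntegrable _ _)
    (by simp)] at s4
  have := hC η hη
  simp only [intervalIntegral.integral_const, smul_eq_mul] at s4
  linarith

/-- boundary hypothesis for the damped cosine transform -/
def BdHyp (g f : ℝ → ℝ) : Prop := ∀ a b : ℝ, 0 < a → a ≤ b → IntegrableOn f (Icc a b) ∧
  Tendsto (fun η => ∫ t in a..b, |uu g η t - f t|) (𝓝[>] 0) (𝓝 0)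

lemma mass_bound' {g f : ℝ → ℝ} (hi : ∀ η > 0, Integrable (fun x => Real.exp (-(η * x)) * g x))
    (hf : BdHyp g f) {r C : ℝ} (hr : 0 < r)
    (hM : ∀ η ∈ Ioc (0:ℝ) 1, ∫ t in (0:ℝ)..r, |uu g η t| ≤ C) (T : ℝ) (hT : 0 < T) :
    ∃ M, ∀ᶠ η in 𝓝[>] (0:ℝ), ∫ t in (0:ℝ)..T, |uu g η t| ≤ M := by
  set T' := max T r with hT'
  have hrT : r ≤ T' := le_max_right _ _
  obtain ⟨f1, f2⟩ := hf r T' hr hrT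
  have f1' : IntervalIntegrable f volume r T' := by
    rw [intervalIntegrable_iff_integrableOn_Icc_of_le hrT]; exact f1
  refine ⟨C + 1 + ∫ t in r..T', |f t|, ?_⟩
  have ev : ∀ᶠ η in 𝓝[>] (0:ℝ), η ∈ Ioc (0:ℝ) 1 := Ioc_mem_nhdsGT one_pos
  filter_upwards [ev, f2.eventually (gt_mem_nhds one_pos)] with η h1 h2
  have hu : Continuous (uu g η) := cosT_continuous (hi η h1.1)
  have hui : ∀ a b, IntervalIntegrable (fun t => |uu g η t|) volume a b :=
    fun a b => hu.abs.intervalIntegrable _ _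
  have s1 : ∫ t in (0:ℝ)..T, |uu g η t| ≤ ∫ t in (0:ℝ)..T', |uu g η t| := by
    apply intervalIntegral.integral_mono_interval le_rfl hT.le (le_max_left _ _) _ (hui _ _)
    exact Eventually.of_forall fun t => abs_nonneg _
  rw [← intervalIntegral.integral_add_adjacent_intervals (hui 0 r) (hui r T')] at s1
  have s2 : ∫ t in r..T', |uu g η t| ≤ ∫ t in r..T', (|uu g η t - f t| + |f t|) := by
    apply intervalIntegral.integral_mono_on hrT (hui _ _)
    · exact ((hu.intervalIntegrable _ _).sub f1').abs.add f1'.abs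
    · intro t _
      have := abs_add_le (uu g η t - f t) (f t)
      simpa using this
  rw [intervalIntegral.integral_add ((hu.intervalIntegrable _ _).sub f1').abs f1'.abs] at s2
  linarith [hM η h1]

lemma f_int {g f : ℝ → ℝ} (hi : ∀ η > 0, Integrable (fun x => Real.exp (-(η * x)) * g x))
    (hf : BdHyp g f) {T M : ℝ} (hT : 0 < T)
    (hM : ∀ᶠ η in 𝓝[>] (0:ℝ), ∫ t in (0:ℝ)..T, |uu g η t| ≤ M) :
    IntegrableOn f (Ioc 0 T) := by
  have ht : Tendsto (fun n : ℕ => T / ((n:ℝ) + 1)) atTop (𝓝 0) := by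
    have := (tendsto_one_div_add_atTop_nhds_zero_nat (𝕜 := ℝ)).const_mul T
    simpa [div_eq_mul_inv] using this
  have hpos : ∀ n : ℕ, 0 < T / ((n:ℝ) + 1) := fun n => by positivity
  have hle : ∀ n : ℕ, T / ((n:ℝ) + 1) ≤ T := fun n =>
    div_le_self hT.le (by have : (0:ℝ) ≤ n := Nat.cast_nonneg n
                          linarith)
  refine integrableOn_Ioc_of_intervalIntegral_norm_bounded_left (l := atTop)
    (I := M + 1) (a := fun n : ℕ => T / ((n:ℝ) + 1)) ?_ ht ?_
  · intro n
    exact (hf _ T (hpos n) (hle n)).1.mono_set Ioc_subset_Icc_self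
  · refine Eventually.of_forall fun n => ?_
    set a := T / ((n:ℝ) + 1)
    obtain ⟨f1, f2⟩ := hf a T (hpos n) (hle n)
    have f1' : IntervalIntegrable f volume a T := by
      rw [intervalIntegrable_iff_integrableOn_Icc_of_le (hle n)]; exact f1
    obtain ⟨η, h1, h2, h3⟩ := (hM.and ((f2.eventually (gt_mem_nhds one_pos)).and
      self_mem_nhdsWithin)).exists
    have hu : Continuous (uu g η) := cosT_continuous (hi η h3)
    have hui : ∀ a b, IntervalIntegrable (fun t => |uu g η t|) volume a b :=
      fun a b => hu.abs.intervalIntegrable _ _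
    have s1 : ∫ t in a..T, |uu g η t| ≤ ∫ t in (0:ℝ)..T, |uu g η t| := by
      apply intervalIntegral.integral_mono_interval (hpos n).le (hle n) le_rfl _ (hui _ _)
      exact Eventually.of_forall fun t => abs_nonneg _
    have s2 : ∫ t in a..T, |f t| ≤ ∫ t in a..T, (|uu g η t - f t| + |uu g η t|) := by
      apply intervalIntegral.integral_mono_on (hle n) f1'.abs
      · exact ((hu.intervalIntegrable _ _).sub f1').abs.add (hui _ _)
      · intro t _
        have := abs_add_le (f t - uu g η t) (uu g η t)
        rw [abs_sub_comm] at this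
        simpa using this
    rw [intervalIntegral.integral_add ((hu.intervalIntegrable _ _).sub f1').abs (hui _ _)] at s2
    rw [← intervalIntegral.integral_of_le (hle n)]
    simp only [Real.norm_eq_abs]
    linarith

lemma limL {g f : ℝ → ℝ} (hi : ∀ η > 0, Integrable (fun x => Real.exp (-(η * x)) * g x))
    (hf : BdHyp g f) {T M : ℝ} (hT : 0 < T)
    (hM : ∀ᶠ η in 𝓝[>] (0:ℝ), ∫ t in (0:ℝ)..T, |uu g η t| ≤ M)
    {ψ : ℝ → ℝ} (hψ : Continuous ψ) (hψ0 : ψ 0 = 0) :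
    Tendsto (fun η => ∫ t in (0:ℝ)..T, ψ t * uu g η t) (𝓝[>] 0)
      (𝓝 (∫ t in (0:ℝ)..T, ψ t * f t)) := by
  have hfi : IntervalIntegrable f volume 0 T := by
    rw [intervalIntegrable_iff_integrableOn_Ioc_of_le hT.le]
    exact f_int hi hf hT hM
  have hM0 : 0 ≤ M := by
    obtain ⟨η, h⟩ := hM.exists
    exact (intervalIntegral.integral_nonneg hT.le (fun t _ => abs_nonneg _)).trans h
  set Mf := ∫ t in (0:ℝ)..T, |f t| with hMf
  have hMf0 : 0 ≤ Mf := intervalIntegral.integral_nonneg hT.le (fun t _ => abs_nonneg _)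
  obtain ⟨B, hB⟩ := isCompact_Icc.exists_bound_of_continuousOn (s := Icc 0 T) hψ.continuousOn
  have hB0 : 0 ≤ B := (norm_nonneg _).trans (hB 0 ⟨le_rfl, hT.le⟩)
  rw [Metric.tendsto_nhds]
  intro ε hε
  set ε' := ε / (2 * (M + Mf + 1)) with hε'
  have hε'0 : 0 < ε' := by positivity
  obtain ⟨δ, hδ0, hδT, hδ⟩ : ∃ δ > 0, δ ≤ T ∧ ∀ t ∈ Icc 0 δ, |ψ t| ≤ ε' := by
    obtain ⟨δ, h1, h2⟩ := Metric.continuousAt_iff.mp (hψ.continuousAt (x := 0)) ε' hε'0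
    refine ⟨min (δ/2) T, by positivity, min_le_right _ _, fun t ht => ?_⟩
    have : dist t 0 < δ := by
      rw [Real.dist_eq, sub_zero, abs_of_nonneg ht.1]
      have := ht.2.trans (min_le_left _ _)
      linarith
    have := h2 this
    rw [hψ0, Real.dist_eq, sub_zero] at this
    exact this.le
  obtain ⟨-, f2⟩ := hf δ T hδ0 hδT
  have hpos : 0 < ε / (2 * (B + 1)) := by positivity
  filter_upwards [hM, f2.eventually (gt_mem_nhds hpos), self_mem_nhdsWithin] with η h1 h2 h3
  have hu : Continuous (uu g η) := cosT_continuous (hi η h3)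
  have hui : ∀ a b, IntervalIntegrable (fun t => |uu g η t|) volume a b :=
    fun a b => hu.abs.intervalIntegrable _ _
  have hd : IntervalIntegrable (fun t => uu g η t - f t) volume 0 T :=
    (hu.intervalIntegrable _ _).sub hfi
  have hpd : IntervalIntegrable (fun t => |ψ t * (uu g η t - f t)|) volume 0 T :=
    (hd.continuousOn_mul hψ.continuousOn).abs
  have sub1 : uIcc 0 δ ⊆ uIcc 0 T := by
    rw [uIcc_of_le hδ0.le, uIcc_of_le hT.le]; exact Icc_subset_Icc_right hδT
  have sub2 : uIcc δ T ⊆ uIcc 0 T := by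
    rw [uIcc_of_le hδT, uIcc_of_le hT.le]; exact Icc_subset_Icc_left hδ0.le
  rw [Real.dist_eq, ← intervalIntegral.integral_sub
    ((by fun_prop : Continuous fun t => ψ t * uu g η t).intervalIntegrable _ _) (hfi.continuousOn_mul hψ.continuousOn)]
  have e : ∀ t, ψ t * uu g η t - ψ t * f t = ψ t * (uu g η t - f t) := fun t => by ring
  simp_rw [e]
  have s0 : |∫ t in (0:ℝ)..T, ψ t * (uu g η t - f t)| ≤ ∫ t in (0:ℝ)..T, |ψ t * (uu g η t - f t)| :=
    intervalIntegral.abs_integral_le_integral_abs hT.le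
  rw [← intervalIntegral.integral_add_adjacent_intervals (hpd.mono_set sub1)
    (hpd.mono_set sub2)] at s0
  have s1 : ∫ t in (0:ℝ)..δ, |ψ t * (uu g η t - f t)| ≤
      ∫ t in (0:ℝ)..δ, ε' * (|uu g η t| + |f t|) := by
    apply intervalIntegral.integral_mono_on hδ0.le (hpd.mono_set sub1)
    · exact ((hui _ _).add (hfi.mono_set sub1).abs).const_mul _
    · intro t ht
      rw [abs_mul]
      exact mul_le_mul (hδ t ht) (abs_sub _ _) (abs_nonneg _) hε'0.le
  rw [intervalIntegral.integral_const_mul, intervalIntegral.integral_add (hui _ _)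
    (hfi.mono_set sub1).abs] at s1
  have s2 : ∫ t in δ..T, |ψ t * (uu g η t - f t)| ≤ ∫ t in δ..T, B * |uu g η t - f t| := by
    apply intervalIntegral.integral_mono_on hδT (hpd.mono_set sub2)
    · exact (hd.mono_set sub2).abs.const_mul _
    · intro t ht
      rw [abs_mul]
      exact mul_le_mul_of_nonneg_right (hB t ⟨hδ0.le.trans ht.1, ht.2⟩) (abs_nonneg _)
  rw [intervalIntegral.integral_const_mul] at s2
  have s3 : ∫ t in (0:ℝ)..δ, |uu g η t| ≤ ∫ t in (0:ℝ)..T, |uu g η t| := by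
    apply intervalIntegral.integral_mono_interval le_rfl hδ0.le hδT _ (hui _ _)
    exact Eventually.of_forall fun t => abs_nonneg _
  have s4 : ∫ t in (0:ℝ)..δ, |f t| ≤ Mf := by
    apply intervalIntegral.integral_mono_interval le_rfl hδ0.le hδT _ hfi.abs
    exact Eventually.of_forall fun t => abs_nonneg _
  have s5 : ε' * ((∫ t in (0:ℝ)..δ, |uu g η t|) + ∫ t in (0:ℝ)..δ, |f t|) ≤ ε' * (M + Mf + 1) := by
    apply mul_le_mul_of_nonneg_left _ hε'0.le
    linarith
  have s6 : ε' * (M + Mf + 1) = ε / 2 := by rw [hε']; field_simp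
  have s7 : B * (∫ t in δ..T, |uu g η t - f t|) < ε / 2 := by
    calc _ ≤ B * (ε / (2 * (B + 1))) := mul_le_mul_of_nonneg_left h2.le hB0
      _ < (B + 1) * (ε / (2 * (B + 1))) := by nlinarith
      _ = ε / 2 := by field_simp
  linarith

/-- Fejer kernel -/
noncomputable def fk (R u : ℝ) : ℝ := R / 2 * Real.sinc (R * u / 2) ^ 2

/-- triangle function -/
noncomputable def tri (R t : ℝ) : ℝ := max 0 (1 - t / R)

/-- symmetrised kernel -/
noncomputable def kap (R y x : ℝ) : ℝ := (fk R (x - y) + fk R (x + y)) / 2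

lemma tri_cont (R : ℝ) : Continuous (tri R) := by
  unfold tri; fun_prop

lemma tri_zero (R : ℝ) : tri R 0 = 1 := by simp [tri]

lemma tri_abs {R t : ℝ} (hR : 0 < R) (ht : 0 ≤ t) : |tri R t| ≤ 1 := by
  have : 0 ≤ t / R := by positivity
  rw [abs_of_nonneg (le_max_left _ _)]
  exact max_le zero_le_one (by linarith)

lemma fk_cont (R : ℝ) : Continuous (fk R) := by
  unfold fk
  have := Real.continuous_sinc
  fun_prop

lemma fk_nonneg {R : ℝ} (hR : 0 < R) (u : ℝ) : 0 ≤ fk R u := by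
  unfold fk; positivity

lemma fk_le {R : ℝ} (hR : 0 < R) (u : ℝ) : fk R u ≤ R * (1 + (R * u / 2)^2)⁻¹ := by
  unfold fk
  generalize R * u / 2 = v
  have h1 : Real.sinc v ^ 2 ≤ 1 := by
    have := Real.abs_sinc_le_one v
    rw [← sq_abs]
    exact pow_le_one₀ (abs_nonneg _) this
  have h2 : v^2 * Real.sinc v ^ 2 ≤ 1 := by
    rcases eq_or_ne v 0 with h | h
    · simp [h]
    · rw [Real.sinc_of_ne_zero h, div_pow, mul_div_cancel₀ _ (by positivity)]
      exact Real.sin_sq_le_one v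
  rw [← div_eq_mul_inv, le_div_iff₀ (by positivity)]
  nlinarith

lemma fk_tri {R T : ℝ} (hR : 0 < R) (hT : R ≤ T) (u : ℝ) :
    ∫ t in (0:ℝ)..T, tri R t * Real.cos (t * u) = fk R u := by
  have hIntg : ∀ (ψ : ℝ → ℝ) (a b : ℝ), Continuous ψ → IntervalIntegrable ψ volume a b :=
    fun ψ a b hψ => hψ.intervalIntegrable _ _
  have hc := tri_cont R
  rw [← intervalIntegral.integral_add_adjacent_intervals (b := R) (hIntg _ _ _ (by fun_prop))
    (hIntg _ _ _ (by fun_prop))]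
  have e2 : ∫ t in R..T, tri R t * Real.cos (t * u) = 0 := by
    rw [intervalIntegral.integral_congr (g := fun _ => 0)]
    · simp
    · intro t ht
      rw [uIcc_of_le hT] at ht
      have : 1 ≤ t / R := by rw [le_div_iff₀ hR]; linarith [ht.1]
      simp [tri, max_eq_left (by linarith : 1 - t / R ≤ 0)]
  have e1 : ∫ t in (0:ℝ)..R, tri R t * Real.cos (t * u) =
      ∫ t in (0:ℝ)..R, (1 - t / R) * Real.cos (t * u) := by
    apply intervalIntegral.integral_congr
    intro t ht
    rw [uIcc_of_le hR.le] at ht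
    have : t / R ≤ 1 := by rw [div_le_one hR]; exact ht.2
    simp [tri, max_eq_right (by linarith : 0 ≤ 1 - t / R)]
  rw [e1, e2, add_zero]
  rcases eq_or_ne u 0 with h | h
  · subst h
    simp only [mul_zero, Real.cos_zero, mul_one, fk, zero_div, Real.sinc_zero, one_pow]
    rw [intervalIntegral.integral_sub (hIntg _ _ _ (by fun_prop)) (hIntg _ _ _ (by fun_prop)),
      intervalIntegral.integral_div, integral_id]
    simp; field_simp; ring
  · have hW : ∀ t : ℝ, HasDerivAt (fun t => (1 - t / R) * (Real.sin (t * u) / u)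
        - Real.cos (t * u) / (R * u^2)) ((1 - t / R) * Real.cos (t * u)) t := by
      intro t
      have b1 : HasDerivAt (fun t => Real.sin (t*u)) (Real.cos (t*u) * (1*u)) t :=
        ((hasDerivAt_id t).mul_const u).sin
      have b2 : HasDerivAt (fun t => Real.cos (t*u)) (-Real.sin (t*u) * (1*u)) t :=
        ((hasDerivAt_id t).mul_const u).cos
      have b3 : HasDerivAt (fun t : ℝ => 1 - t / R) (-(1 / R)) t :=
        ((hasDerivAt_id t).div_const R).const_sub 1
      refine ((b3.mul (b1.div_const u)).sub (b2.div_const (R * u^2))).congr_deriv ?_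
      field_simp; ring
    rw [intervalIntegral.integral_eq_sub_of_hasDerivAt (fun t _ => hW t)
      (hIntg _ _ _ (by fun_prop))]
    unfold fk
    rw [Real.sinc_of_ne_zero (by positivity)]
    have : Real.cos (R * u) = 1 - 2 * Real.sin (R*u/2)^2 := by
      have h1 := Real.cos_two_mul (R*u/2)
      have h2 := Real.sin_sq_add_cos_sq (R*u/2)
      rw [show 2 * (R*u/2) = R * u by ring] at h1
      linarith
    rw [this]
    simp
    field_simp
    ring

lemma kap_eq {R T : ℝ} (hR : 0 < R) (hT : R ≤ T) (y x : ℝ) :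
    ∫ t in (0:ℝ)..T, (tri R t * Real.cos (y * t)) * Real.cos (t * x) = kap R y x := by
  unfold kap
  have hc := tri_cont R
  rw [← fk_tri hR hT, ← fk_tri hR hT, ← intervalIntegral.integral_add
    ((by fun_prop : Continuous _).intervalIntegrable _ _)
    ((by fun_prop : Continuous _).intervalIntegrable _ _), ← intervalIntegral.integral_div]
  congr 1; ext t
  have h1 := Real.cos_add (t*x) (y*t)
  have h2 := Real.cos_sub (t*x) (y*t)
  rw [show t * (x - y) = t*x - y*t by ring, show t * (x+y) = t*x+y*t by ring, h1, h2]
  ring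

/-- total mass -/
noncomputable def Isc : ℝ := ∫ v, fk 2 v

lemma fk_integrable {R : ℝ} (hR : 0 < R) : Integrable (fk R) := by
  have h1 : Integrable (fun u : ℝ => R * (1 + (R * u / 2)^2)⁻¹) := by
    have := (integrable_inv_one_add_sq.comp_mul_left' (g := fun x : ℝ => (1 + x^2)⁻¹)
      (R := R/2) (by positivity)).const_mul R
    refine this.congr (Eventually.of_forall fun x => ?_)
    simp only
    rw [show R / 2 * x = R * x / 2 by ring]
  refine h1.mono' (fk_cont R).aestronglyMeasurable (Eventually.of_forall fun u => ?_)
  rw [Real.norm_eq_abs, abs_of_nonneg (fk_nonneg hR u)]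
  exact fk_le hR u

lemma fk_mass {R : ℝ} (hR : 0 < R) : ∫ u, fk R u = Isc := by
  have h := Measure.integral_comp_mul_left (fun v => fk 2 v) (R/2)
  have e : ∀ u, fk R u = (R/2) * fk 2 (R/2*u) := by
    intro u; unfold fk
    rw [show 2 * (R / 2 * u) / 2 = R * u / 2 by ring]; ring
  simp_rw [e]
  rw [integral_const_mul, h, abs_of_pos (by positivity), smul_eq_mul, ← mul_assoc,
    mul_inv_cancel₀ (by positivity), one_mul]
  rfl

lemma Isc_pos : 0 < Isc := by
  unfold Isc
  rw [integral_pos_iff_support_of_nonneg (fk_nonneg (by norm_num)) (fk_integrable (by norm_num))]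
  exact (fk_cont 2).isOpen_support.measure_pos _ ⟨0, by simp [fk]⟩

lemma fk_tail {δ : ℝ} (hδ : 0 < δ) {ε : ℝ} (hε : 0 < ε) :
    ∃ R ≥ 1, ∫ u, {u | δ < |u|}.indicator (fk R) u ≤ ε := by
  set Q := 4 * (1 + 1/δ^2) * Real.pi with hQ
  have hQ0 : 0 < Q := by positivity
  set R := max 1 (Q / ε) with hRdef
  have hR1 : 1 ≤ R := le_max_left _ _
  have hR0 : 0 < R := by linarith
  refine ⟨R, hR1, ?_⟩
  have hb : ∀ u, {u | δ < |u|}.indicator (fk R) u ≤ 4 / R * (1 + 1/δ^2) * (1 + u^2)⁻¹ := by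
    intro u
    by_cases hu : u ∈ {u | δ < |u|}
    · rw [indicator_of_mem hu]
      refine (fk_le hR0 u).trans ?_
      have hu : δ < |u| := hu
      have hu2 : δ^2 ≤ u^2 := by rw [← sq_abs u]; exact pow_le_pow_left₀ hδ.le hu.le 2
      have hup : 0 < u^2 := lt_of_lt_of_le (by positivity) hu2
      have : (1 + (R * u / 2)^2)⁻¹ ≤ 4 / (R^2 * u^2) := by
        rw [inv_eq_one_div, div_le_div_iff₀ (by positivity) (by positivity)]
        nlinarith
      calc R * (1 + (R * u / 2)^2)⁻¹ ≤ R * (4 / (R^2 * u^2)) :=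
            mul_le_mul_of_nonneg_left this hR0.le
        _ = 4 / R * (1 / u^2) := by field_simp
        _ ≤ 4 / R * ((1 + 1/δ^2) * (1 + u^2)⁻¹) := by
            apply mul_le_mul_of_nonneg_left _ (by positivity)
            rw [← div_eq_mul_inv, div_le_div_iff₀ hup (by positivity)]
            have : 1 ≤ 1/δ^2 * u^2 := by
              rw [one_div, inv_mul_eq_div, le_div_iff₀ (by positivity)]; linarith
            nlinarith
        _ = _ := by ring
    · rw [indicator_of_notMem hu]; positivity
  have hm : MeasurableSet {u : ℝ | δ < |u|} := measurableSet_lt measurable_const (by fun_prop)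
  calc ∫ u, {u | δ < |u|}.indicator (fk R) u ≤ ∫ u, 4 / R * (1 + 1/δ^2) * (1 + u^2)⁻¹ := by
        apply integral_mono ((fk_integrable hR0).indicator hm)
          (integrable_inv_one_add_sq.const_mul _) hb
    _ = Q / R := by
        rw [integral_const_mul, integral_univ_inv_one_add_sq]; rw [hQ]; ring
    _ ≤ ε := by
        rw [div_le_iff₀ hR0]
        have := le_max_right 1 (Q/ε)
        rw [div_le_iff₀ hε] at this
        linarith

lemma fk_lower {u : ℝ} (h0 : 0 ≤ u) (h1 : u ≤ 1) : 1/8 ≤ fk 1 u := by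
  unfold fk
  have : 1/2 ≤ Real.sinc (1 * u / 2) := by
    rcases h0.eq_or_lt with h | h
    · rw [← h]; simp; norm_num
    · rw [Real.sinc_of_ne_zero (by positivity), le_div_iff₀ (by positivity)]
      have := Real.sin_gt_sub_cube (x := 1 * u / 2) (by positivity)
      have h3 : (1*u/2)^3 ≤ (1*u/2) * 1 := by
        have : (1*u/2)^2 ≤ 1 := by nlinarith
        nlinarith
      nlinarith
  nlinarith

lemma kap_nonneg {R : ℝ} (hR : 0 < R) (y x : ℝ) : 0 ≤ kap R y x := by
  unfold kap
  have := fk_nonneg hR (x-y)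
  have := fk_nonneg hR (x+y)
  linarith

lemma kap_cont (R y : ℝ) : Continuous (kap R y) := by
  unfold kap
  have := fk_cont R
  fun_prop

lemma kap_integrable {R : ℝ} (hR : 0 < R) (y : ℝ) : Integrable (kap R y) :=
  (((fk_integrable hR).comp_sub_right y).add ((fk_integrable hR).comp_add_right y)).div_const 2

lemma kap_mass {R : ℝ} (hR : 0 < R) (y : ℝ) : ∫ x, kap R y x = Isc := by
  unfold kap
  rw [integral_div, integral_add ((fk_integrable hR).comp_sub_right y)
    ((fk_integrable hR).comp_add_right y), integral_sub_right_eq_self (fk R),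
    integral_add_right_eq_self (fk R), fk_mass hR]
  ring

lemma fub_kap {g : ℝ → ℝ} (hi : ∀ η > 0, Integrable (fun x => Real.exp (-(η * x)) * g x))
    {R T : ℝ} (hR : 0 < R) (hT : R ≤ T) (y : ℝ) {η : ℝ} (hη : 0 < η) :
    ∫ t in (0:ℝ)..T, (tri R t * Real.cos (y * t)) * uu g η t =
      ∫ x, Real.exp (-(η * x)) * g x * kap R y x := by
  have hc := tri_cont R
  have := cosT_fubini (hi η hη) (ψ := fun t => tri R t * Real.cos (y * t)) (by fun_prop) T
  simp_rw [kap_eq hR hT] at this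
  exact this

lemma kap_bdd {R : ℝ} (hR : 0 < R) (y x : ℝ) : ‖kap R y x‖ ≤ R := by
  have key : ∀ u, fk R u ≤ R := fun u => (fk_le hR u).trans (by
    apply mul_le_of_le_one_right hR.le
    apply inv_le_one_of_one_le₀
    nlinarith [sq_nonneg (R * u / 2)])
  rw [Real.norm_eq_abs, abs_of_nonneg (kap_nonneg hR y x)]
  unfold kap
  linarith [key (x-y), key (x+y)]

lemma g_kap_integrable {g : ℝ → ℝ}
    (hi : ∀ η > 0, Integrable (fun x => Real.exp (-(η * x)) * g x))
    {R : ℝ} (hR : 0 < R) (y : ℝ) {η : ℝ} (hη : 0 < η) :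
    Integrable (fun x => Real.exp (-(η * x)) * g x * kap R y x) :=
  (hi η hη).mul_bdd (c := R) (kap_cont R y).aestronglyMeasurable
    (Eventually.of_forall (kap_bdd hR y))

lemma g_upper {g : ℝ → ℝ} (hi : ∀ η > 0, Integrable (fun x => Real.exp (-(η * x)) * g x))
    (h0 : ∀ x < 0, g x = 0) {C h x₀ : ℝ} (hC : 0 ≤ C) (hlow : ∀ x, -C ≤ g x) (hh : 0 < h)
    (hx0 : 0 ≤ x₀)
    (hslow : ∀ x y, x₀ ≤ x → x ≤ y → y ≤ x + h → Real.exp (x - y) * (g x - 1) ≤ g y)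
    {M : ℝ} (hM : ∀ᶠ η in 𝓝[>] (0:ℝ), ∫ t in (0:ℝ)..1, |uu g η t| ≤ M) :
    ∃ B, ∀ y ≥ x₀, g y ≤ B := by
  wlog hh1 : h ≤ 1 generalizing h
  · exact this one_pos (fun x y h1 h2 h3 => hslow x y h1 h2 (by linarith)) le_rfl
  refine ⟨1 + (M + C * Isc) * (16 * Real.exp 2) / h + |1 + (M + C * Isc) * (16 * Real.exp 2) / h|,
    fun y hy => ?_⟩
  rcases le_or_gt (g y) 1 with hg | hg
  · have hM0 : 0 ≤ M := by
      obtain ⟨η, h⟩ := hM.exists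
      exact (intervalIntegral.integral_nonneg zero_le_one (fun t _ => abs_nonneg _)).trans h
    have : 0 ≤ (M + C * Isc) * (16 * Real.exp 2) / h := by
      have := Isc_pos
      positivity
    linarith [abs_nonneg (1 + (M + C * Isc) * (16 * Real.exp 2) / h)]
  have hy0 : 0 ≤ y := hx0.trans hy
  have hp : 0 < 1 / (y + 1) := by positivity
  obtain ⟨η, h1, h2⟩ := (hM.and (Ioc_mem_nhdsGT hp)).exists
  have hη := h2.1
  have hηy : η * (y + 1) ≤ 1 := by
    have := h2.2
    rwa [le_div_iff₀ (by positivity)] at this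
  have hu : Continuous (uu g η) := cosT_continuous (hi η hη)
  have hc := tri_cont 1
  have s1 : ∫ x, Real.exp (-(η * x)) * g x * kap 1 y x ≤ M := by
    rw [← fub_kap hi one_pos le_rfl y hη]
    refine le_trans ?_ h1
    apply intervalIntegral.integral_mono_on zero_le_one
    · exact (by fun_prop : Continuous _).intervalIntegrable _ _
    · exact (by fun_prop : Continuous _).intervalIntegrable _ _
    · intro t ht
      refine (le_abs_self _).trans ?_
      rw [abs_mul, abs_mul]
      apply mul_le_of_le_one_left (abs_nonneg _)
      exact mul_le_one₀ (tri_abs one_pos ht.1) (abs_nonneg _) (Real.abs_cos_le_one _)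
  set d := Real.exp (-2) * (g y - 1) * (1/16) with hd
  have hpt : ∀ x, (Icc y (y+h)).indicator (fun _ => d) x ≤
      Real.exp (-(η * x)) * g x * kap 1 y x + C * kap 1 y x := by
    intro x
    have hk := kap_nonneg one_pos y x
    have hCk : 0 ≤ C * kap 1 y x := mul_nonneg hC hk
    by_cases hx : x ∈ Icc y (y+h)
    · rw [indicator_of_mem hx]
      have k1 : 1/16 ≤ kap 1 y x := by
        unfold kap
        have a1 := fk_lower (u := x - y) (by linarith [hx.1]) (by linarith [hx.2])
        have a2 := fk_nonneg one_pos (x + y)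
        linarith
      have k2 := hslow y x hy hx.1 hx.2
      have k3 : Real.exp (-1) * (g y - 1) ≤ g x := by
        refine le_trans ?_ k2
        apply mul_le_mul_of_nonneg_right _ (by linarith)
        apply Real.exp_le_exp.mpr; linarith [hx.2]
      have k4 : Real.exp (-1) ≤ Real.exp (-(η * x)) := by
        apply Real.exp_le_exp.mpr
        have : η * x ≤ η * (y+1) := mul_le_mul_of_nonneg_left (by linarith [hx.2]) hη.le
        linarith
      have k5 : d ≤ Real.exp (-(η * x)) * g x * kap 1 y x := by
        have e : Real.exp (-2) = Real.exp (-1) * Real.exp (-1) := by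
          rw [← Real.exp_add]; norm_num
        rw [hd, e, mul_assoc (Real.exp (-1))]
        have p1 : 0 ≤ Real.exp (-1) * (g y - 1) := mul_nonneg (Real.exp_pos _).le (by linarith)
        apply mul_le_mul _ k1 (by norm_num)
        · exact mul_nonneg (Real.exp_pos _).le (p1.trans k3)
        · exact mul_le_mul k4 k3 p1 (Real.exp_pos _).le
      linarith
    · rw [indicator_of_notMem hx]
      rcases lt_or_ge x 0 with hx0 | hx0
      · rw [h0 x hx0]; simpa using hCk
      · have e1 : Real.exp (-(η*x)) ≤ 1 := Real.exp_le_one_iff.mpr (by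
          have := mul_nonneg hη.le hx0; linarith)
        have e2 := Real.exp_pos (-(η*x))
        have : 0 ≤ Real.exp (-(η*x)) * g x + C := by nlinarith [hlow x]
        have := mul_nonneg this hk
        linarith
  have s2 := integral_mono (μ := volume)
    ((integrable_indicator_iff measurableSet_Icc).mpr (by simp))
    ((g_kap_integrable hi one_pos y hη).add ((kap_integrable one_pos y).const_mul C)) hpt
  rw [integral_add' (g_kap_integrable hi one_pos y hη) ((kap_integrable one_pos y).const_mul C),
    integral_const_mul, kap_mass one_pos, integral_indicator measurableSet_Icc] at s2
  simp [hh.le] at s2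
  have s3 : h * d ≤ M + C * Isc := by linarith
  have s4 : g y - 1 ≤ (M + C * Isc) * (16 * Real.exp 2) / h := by
    rw [le_div_iff₀ hh]
    have : h * d * (16 * Real.exp 2) = (g y - 1) * h := by
      rw [hd]
      have : Real.exp (-2) * Real.exp 2 = 1 := by rw [← Real.exp_add]; simp
      linear_combination (h * (g y - 1)) * this
    rw [← this]
    exact mul_le_mul_of_nonneg_right s3 (by positivity)
  linarith [abs_nonneg (1 + (M + C * Isc) * (16 * Real.exp 2) / h)]

lemma riemann_leb {F : ℝ → ℝ} {T : ℝ} (hT : 0 ≤ T) (hF : IntervalIntegrable F volume 0 T) :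
    Tendsto (fun y => ∫ t in (0:ℝ)..T, F t * Real.cos (y * t)) atTop (𝓝 0) := by
  have hF' : IntegrableOn F (Ioc 0 T) := (intervalIntegrable_iff_integrableOn_Ioc_of_le hT).mp hF
  have hFi : Integrable ((Ioc 0 T).indicator F) := (integrable_indicator_iff measurableSet_Ioc).mpr hF'
  have h1 := Real.tendsto_integral_exp_smul_cocompact (fun t => (((Ioc 0 T).indicator F t : ℝ) : ℂ))
  have h2 : Tendsto (fun y : ℝ => y / (2 * Real.pi)) atTop (cocompact ℝ) :=
    (tendsto_id.atTop_div_const (by positivity)).mono_right atTop_le_cocompact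
  have h3 := (Complex.continuous_re.tendsto _).comp (h1.comp h2)
  simp only [Complex.zero_re] at h3
  refine h3.congr fun y => ?_
  simp only [Function.comp]
  have hii : Integrable (fun v : ℝ => Real.fourierChar (-(v * (y / (2 * Real.pi)))) •
      (((Ioc 0 T).indicator F v : ℝ) : ℂ)) := by
    rw [← integrable_norm_iff]
    · simpa [Circle.norm_smul] using hFi.norm
    · apply AEStronglyMeasurable.smul
      · have : Continuous fun v : ℝ => Real.fourierChar (-(v * (y / (2 * Real.pi)))) := by
          fun_prop
        exact (continuous_subtype_val.comp this).aestronglyMeasurable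
      · exact hFi.ofReal.aestronglyMeasurable
  have : (∫ v : ℝ, Real.fourierChar (-(v * (y / (2 * Real.pi)))) •
      (((Ioc 0 T).indicator F v : ℝ) : ℂ)).re = ∫ v : ℝ, (Real.fourierChar (-(v * (y / (2 * Real.pi)))) •
      (((Ioc 0 T).indicator F v : ℝ) : ℂ)).re := by
    exact (integral_re hii).symm
  rw [this, intervalIntegral.integral_of_le hT, ← integral_indicator measurableSet_Ioc]
  congr 1; ext v
  rw [Circle.smul_def, Real.fourierChar_apply, smul_eq_mul, Complex.re_mul_ofReal,
    Complex.exp_ofReal_mul_I_re]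
  by_cases hv : v ∈ Ioc 0 T
  · rw [indicator_of_mem hv, indicator_of_mem hv, mul_comm]
    congr 1
    rw [← Real.cos_neg]
    congr 1
    field_simp
  · rw [indicator_of_notMem hv, indicator_of_notMem hv, mul_zero]

lemma J_lim {g : ℝ → ℝ} (hi : ∀ η > 0, Integrable (fun x => Real.exp (-(η * x)) * g x))
    (h0 : ∀ x < 0, g x = 0) {B : ℝ} (hB : ∀ x, |g x| ≤ B) {R : ℝ} (hR : 0 < R) (y : ℝ) :
    Tendsto (fun η => ∫ x, Real.exp (-(η * x)) * g x * kap R y x) (𝓝[>] 0)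
      (𝓝 (∫ x, g x * kap R y x)) := by
  refine tendsto_integral_filter_of_dominated_convergence (fun x => B * kap R y x) ?_ ?_
    ((kap_integrable hR y).const_mul B) ?_
  · filter_upwards [self_mem_nhdsWithin] with η hη
    exact (g_kap_integrable hi hR y hη).aestronglyMeasurable
  · filter_upwards [self_mem_nhdsWithin] with η hη
    refine Eventually.of_forall fun x => ?_
    have hη : 0 < η := hη
    rw [norm_mul, Real.norm_eq_abs, Real.norm_eq_abs (kap R y x), abs_of_nonneg (kap_nonneg hR y x)]
    apply mul_le_mul_of_nonneg_right _ (kap_nonneg hR y x)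
    rcases lt_or_ge x 0 with hx | hx
    · rw [h0 x hx]; simpa using (abs_nonneg _).trans (hB 0)
    · rw [abs_mul, Real.abs_exp]
      refine (mul_le_of_le_one_left (abs_nonneg _) ?_).trans (hB x)
      exact Real.exp_le_one_iff.mpr (by have := mul_nonneg hη.le hx; linarith)
  · refine Eventually.of_forall fun x => ?_
    have : Continuous fun η : ℝ => Real.exp (-(η * x)) * g x * kap R y x := by fun_prop
    have h2 := this.tendsto 0
    simp only [zero_mul, neg_zero, Real.exp_zero, one_mul] at h2
    exact h2.mono_left nhdsWithin_le_nhds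

lemma J_asymp {g f : ℝ → ℝ} (hi : ∀ η > 0, Integrable (fun x => Real.exp (-(η * x)) * g x))
    (h0 : ∀ x < 0, g x = 0) {B : ℝ} (hB : ∀ x, |g x| ≤ B) (hf : BdHyp g f)
    (hM : ∀ T > 0, ∃ M, ∀ᶠ η in 𝓝[>] (0:ℝ), ∫ t in (0:ℝ)..T, |uu g η t| ≤ M) :
    ∃ A, ∀ R ≥ 1, Tendsto (fun y => ∫ x, g x * kap R y x) atTop (𝓝 A) := by
  have hfi : ∀ T > 0, IntervalIntegrable f volume 0 T := by
    intro T hT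
    obtain ⟨M, hM⟩ := hM T hT
    rw [intervalIntegrable_iff_integrableOn_Ioc_of_le hT.le]
    exact f_int hi hf hT hM
  refine ⟨(∫ x, g x * kap 1 0 x) - ∫ t in (0:ℝ)..1, tri 1 t * f t, fun R hR => ?_⟩
  have hR0 : 0 < R := by linarith
  obtain ⟨M, hMR⟩ := hM R hR0
  have hc := tri_cont R
  have hc1 := tri_cont 1
  have e1 : ∫ t in (0:ℝ)..R, tri 1 t * f t = ∫ t in (0:ℝ)..1, tri 1 t * f t := by
    have hh : IntervalIntegrable (fun t => tri 1 t * f t) volume 0 R :=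
      (hfi R hR0).continuousOn_mul hc1.continuousOn
    rw [← intervalIntegral.integral_add_adjacent_intervals (b := 1)
      (hh.mono_set (by rw [uIcc_of_le zero_le_one, uIcc_of_le hR0.le]
                       exact Icc_subset_Icc_right hR))
      (hh.mono_set (by rw [uIcc_of_le hR, uIcc_of_le hR0.le]
                       exact Icc_subset_Icc_left zero_le_one))]
    rw [intervalIntegral.integral_congr (a := 1) (b := R) (g := fun _ => 0)]
    · simp
    · intro t ht
      rw [uIcc_of_le hR] at ht
      simp [tri, ht.1]
  have key : ∀ y, ∫ x, g x * kap R y x = (∫ x, g x * kap 1 0 x)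
      - (∫ t in (0:ℝ)..1, tri 1 t * f t) + ∫ t in (0:ℝ)..R, (tri R t * f t) * Real.cos (y * t) := by
    intro y
    have l1 := limL hi hf hR0 hMR (ψ := fun t => tri R t * Real.cos (y*t) - tri 1 t)
      (by fun_prop) (by simp [tri_zero])
    have l2 := (J_lim hi h0 hB hR0 y).sub (J_lim hi h0 hB one_pos 0)
    have l3 : Tendsto (fun η => ∫ t in (0:ℝ)..R, (tri R t * Real.cos (y*t) - tri 1 t) * uu g η t)
        (𝓝[>] 0) (𝓝 ((∫ x, g x * kap R y x) - ∫ x, g x * kap 1 0 x)) := by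
      refine l2.congr' ?_
      filter_upwards [self_mem_nhdsWithin] with η hη
      have hu : Continuous (uu g η) := cosT_continuous (hi η hη)
      rw [← fub_kap hi hR0 le_rfl y hη, ← fub_kap hi one_pos hR 0 hη,
        ← intervalIntegral.integral_sub
          ((by fun_prop : Continuous _).intervalIntegrable _ _)
          ((by fun_prop : Continuous _).intervalIntegrable _ _)]
      congr 1; ext t
      simp; ring
    have l4 := tendsto_nhds_unique l3 l1
    have l5 : ∫ t in (0:ℝ)..R, (tri R t * Real.cos (y*t) - tri 1 t) * f t =
        (∫ t in (0:ℝ)..R, (tri R t * f t) * Real.cos (y * t)) - ∫ t in (0:ℝ)..R, tri 1 t * f t := by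
      rw [← intervalIntegral.integral_sub]
      · congr 1; ext t; ring
      · refine ((hfi R hR0).continuousOn_mul hc.continuousOn).mul_continuousOn ?_
        exact (by fun_prop : Continuous _).continuousOn
      · exact (hfi R hR0).continuousOn_mul hc1.continuousOn
    rw [l5, e1] at l4
    linarith
  simp_rw [key]
  have := (riemann_leb hR0.le ((hfi R hR0).continuousOn_mul hc.continuousOn)).const_add
    ((∫ x, g x * kap 1 0 x) - (∫ t in (0:ℝ)..1, tri 1 t * f t))
  simpa using this

lemma g_fk_integrable {g : ℝ → ℝ} (hgm : AEStronglyMeasurable g volume) {B : ℝ}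
    (hB : ∀ x, |g x| ≤ B) {R : ℝ} (hR : 0 < R) (y : ℝ) :
    Integrable (fun x => g x * fk R (x - y)) :=
  ((fk_integrable hR).comp_sub_right y).bdd_mul (c := B) hgm
    (Eventually.of_forall fun x => by simpa using hB x)

lemma G_asymp {g : ℝ → ℝ} (hgm : AEStronglyMeasurable g volume)
    (h0 : ∀ x < 0, g x = 0) {B : ℝ} (hB : ∀ x, |g x| ≤ B) {A R : ℝ} (hR : 0 < R)
    (hA : Tendsto (fun y => ∫ x, g x * kap R y x) atTop (𝓝 A)) :
    Tendsto (fun y => ∫ x, g x * fk R (x - y)) atTop (𝓝 (2 * A)) := by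
  have hB0 : 0 ≤ B := (abs_nonneg _).trans (hB 0)
  have h1 : Tendsto (fun y => ∫ x, g x * fk R (x + y)) atTop (𝓝 (∫ x : ℝ, (0:ℝ))) := by
    have hb : Integrable (fun u : ℝ => B * (R * (1 + (R * u / 2)^2)⁻¹)) := by
      have := ((integrable_inv_one_add_sq.comp_mul_left' (g := fun x : ℝ => (1 + x^2)⁻¹)
        (R := R/2) (by positivity)).const_mul R).const_mul B
      refine this.congr (Eventually.of_forall fun x => ?_)
      simp only
      rw [show R / 2 * x = R * x / 2 by ring]
    refine tendsto_integral_filter_of_dominated_convergence _ ?_ ?_ hb ?_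
    · refine Eventually.of_forall fun y => ?_
      have := g_fk_integrable hgm hB hR (-y)
      simpa using this.aestronglyMeasurable
    · filter_upwards [eventually_ge_atTop 0] with y hy
      refine Eventually.of_forall fun x => ?_
      rcases lt_or_ge x 0 with hx | hx
      · rw [h0 x hx]; simp; positivity
      · rw [norm_mul, Real.norm_eq_abs, Real.norm_eq_abs, abs_of_nonneg (fk_nonneg hR _)]
        apply mul_le_mul (hB x) _ (fk_nonneg hR _) hB0
        refine (fk_le hR _).trans ?_
        apply mul_le_mul_of_nonneg_left _ hR.le
        apply inv_anti₀ (by positivity)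
        have : R * x / 2 ≤ R * (x + y) / 2 := by nlinarith
        have h3 : 0 ≤ R * x / 2 := by positivity
        nlinarith
    · refine Eventually.of_forall fun x => ?_
      have : Tendsto (fun y => fk R (x + y)) atTop (𝓝 0) := by
        have hl : Tendsto (fun y : ℝ => R * (1 + (R * (x + y) / 2)^2)⁻¹) atTop (𝓝 (R * 0)) := by
          apply Tendsto.const_mul
          apply Tendsto.comp tendsto_inv_atTop_zero
          apply tendsto_atTop_add_const_left
          apply (tendsto_pow_atTop (by norm_num)).comp
          apply Tendsto.atTop_div_const (by norm_num)
          apply Tendsto.const_mul_atTop hR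
          exact tendsto_atTop_add_const_left _ _ tendsto_id
        rw [mul_zero] at hl
        exact squeeze_zero (fun y => fk_nonneg hR _) (fun y => fk_le hR _) hl
      simpa using this.const_mul (g x)
  have h2 := (hA.const_mul 2).sub h1
  simp only [integral_zero, sub_zero] at h2
  refine h2.congr fun y => ?_
  have i2 : Integrable (fun x => g x * fk R (x + y)) := by
    simpa using g_fk_integrable hgm hB hR (-y)
  have e : ∫ x, g x * kap R y x = ((∫ x, g x * fk R (x - y)) + ∫ x, g x * fk R (x + y)) / 2 := by
    rw [← integral_add (g_fk_integrable hgm hB hR y) i2, ← integral_div]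
    congr 1; ext x; unfold kap; ring
  rw [e]; ring

lemma tauber {g : ℝ → ℝ} (hgm : AEStronglyMeasurable g volume) {B : ℝ} (hB : ∀ x, |g x| ≤ B)
    {a : ℝ} (hG : ∀ R ≥ 1, Tendsto (fun y => ∫ x, g x * fk R (x - y)) atTop (𝓝 (a * Isc)))
    (hslow : ∀ ε > 0, ∃ h > 0, ∃ X, ∀ x y, X ≤ x → x ≤ y → y ≤ x + h →
      Real.exp (x - y) * (g x - ε) ≤ g y) :
    Tendsto g atTop (𝓝 a) := by
  have hB0 : 0 ≤ B := (abs_nonneg _).trans (hB 0)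
  have hI := Isc_pos
  have slow2 : ∀ ε > 0, ∃ δ > 0, ∃ X, ∀ x y, X ≤ x → x ≤ y → y ≤ x + 2 * δ → g x - ε ≤ g y := by
    intro ε hε
    obtain ⟨h, hh, X, hX⟩ := hslow (ε/2) (by positivity)
    refine ⟨min (h/2) (ε / (4 * (B + ε))), by positivity, X, fun x y h1 h2 h3 => ?_⟩
    have d1 := min_le_left (h/2) (ε / (4 * (B + ε)))
    have d2 := min_le_right (h/2) (ε / (4 * (B + ε)))
    have k := hX x y h1 h2 (by linarith)
    have k2 : x - y + 1 ≤ Real.exp (x - y) := Real.add_one_le_exp _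
    have k3 : Real.exp (x - y) ≤ 1 := Real.exp_le_one_iff.mpr (by linarith)
    have k4 : (1 - Real.exp (x-y)) ≤ 2 * (ε / (4 * (B + ε))) := by linarith
    have k5 : |g x - ε/2| ≤ B + ε := by
      have := abs_sub (g x) (ε/2)
      rw [abs_of_pos (by positivity : 0 < ε/2)] at this
      linarith [hB x]
    have k6 : (1 - Real.exp (x-y)) * |g x - ε/2| ≤ 2 * (ε / (4 * (B + ε))) * (B + ε) :=
      mul_le_mul k4 k5 (abs_nonneg _) (by positivity)
    have k7 : 2 * (ε / (4 * (B + ε))) * (B + ε) = ε/2 := by field_simp; ring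
    have k8 := le_abs_self (g x - ε/2)
    nlinarith
  rw [Metric.tendsto_nhds]
  intro ε0 hε0
  set ε := ε0 / 4 with hε
  have hεp : 0 < ε := by positivity
  obtain ⟨δ, hδ, X, hX⟩ := slow2 ε hεp
  obtain ⟨R, hR, htail⟩ := fk_tail hδ (ε := ε * Isc / (2 * B + ε)) (by positivity)
  have hR0 : 0 < R := by linarith
  set W := {u : ℝ | δ < |u|} with hW
  have hm : MeasurableSet W := measurableSet_lt measurable_const (by fun_prop)
  have htail' : (2 * B + ε) * ∫ u, W.indicator (fk R) u ≤ ε * Isc := by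
    calc _ ≤ (2 * B + ε) * (ε * Isc / (2 * B + ε)) := by
          apply mul_le_mul_of_nonneg_left htail; positivity
      _ = _ := by field_simp
  have hWi := (fk_integrable hR0).indicator hm
  have hWn : ∀ u, 0 ≤ W.indicator (fk R) u := fun u =>
    indicator_nonneg (fun u _ => fk_nonneg hR0 u) u
  have hlim := Metric.tendsto_nhds.mp (hG R hR) (ε * Isc) (by positivity)
  have t1 : Tendsto (fun y : ℝ => y + δ) atTop atTop := tendsto_atTop_add_const_right _ _ tendsto_id
  have t2 : Tendsto (fun y : ℝ => y - δ) atTop atTop := tendsto_atTop_add_const_right _ _ tendsto_id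
  filter_upwards [t1.eventually hlim, t2.eventually hlim, eventually_ge_atTop (X + 2 * δ)]
    with y u1 u2 hy
  rw [Real.dist_eq, abs_lt] at *
  have mass : ∀ c z : ℝ, ∫ x, c * fk R (x - z) = c * Isc := by
    intro c z
    rw [integral_const_mul, integral_sub_right_eq_self (fk R), fk_mass hR0]
  have tail : ∀ z : ℝ, ∫ x, (2 * B + ε) * W.indicator (fk R) (x - z) ≤ ε * Isc := by
    intro z
    rw [integral_const_mul, integral_sub_right_eq_self (W.indicator (fk R))]
    exact htail'
  have iF : ∀ c z : ℝ, Integrable (fun x => c * fk R (x - z)) := fun c z =>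
    ((fk_integrable hR0).comp_sub_right z).const_mul c
  have iT : ∀ z : ℝ, Integrable (fun x => (2 * B + ε) * W.indicator (fk R) (x - z)) := fun z =>
    (hWi.comp_sub_right z).const_mul _
  have hBy := abs_le.mp (hB y)
  have up : (g y - ε) * Isc ≤ (∫ x, g x * fk R (x - (y + δ))) + ε * Isc := by
    have p : ∀ x, (g y - ε) * fk R (x - (y+δ)) ≤
        g x * fk R (x - (y+δ)) + (2 * B + ε) * W.indicator (fk R) (x - (y+δ)) := by
      intro x
      have hn := fk_nonneg hR0 (x - (y+δ))
      have hBx := abs_le.mp (hB x)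
      by_cases hx : x - (y+δ) ∈ W
      · rw [indicator_of_mem hx, ← add_mul]
        apply mul_le_mul_of_nonneg_right _ hn
        linarith
      · rw [indicator_of_notMem hx, mul_zero, add_zero]
        apply mul_le_mul_of_nonneg_right _ hn
        have hx : |x - (y+δ)| ≤ δ := not_lt.mp hx
        rw [abs_le] at hx
        exact hX y x (by linarith) (by linarith) (by linarith)
    have := integral_mono (iF _ _) ((g_fk_integrable hgm hB hR0 _).add (iT _)) p
    rw [mass, integral_add' (g_fk_integrable hgm hB hR0 _) (iT _)] at this
    linarith [tail (y+δ)]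
  have lo : (∫ x, g x * fk R (x - (y - δ))) ≤ (g y + ε) * Isc + ε * Isc := by
    have p : ∀ x, g x * fk R (x - (y-δ)) ≤
        (g y + ε) * fk R (x - (y-δ)) + (2 * B + ε) * W.indicator (fk R) (x - (y-δ)) := by
      intro x
      have hn := fk_nonneg hR0 (x - (y-δ))
      have hBx := abs_le.mp (hB x)
      by_cases hx : x - (y-δ) ∈ W
      · rw [indicator_of_mem hx, ← add_mul]
        apply mul_le_mul_of_nonneg_right _ hn
        linarith
      · rw [indicator_of_notMem hx, mul_zero, add_zero]
        apply mul_le_mul_of_nonneg_right _ hn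
        have hx : |x - (y-δ)| ≤ δ := not_lt.mp hx
        rw [abs_le] at hx
        linarith [hX x y (by linarith) (by linarith) (by linarith)]
    have := integral_mono (g_fk_integrable hgm hB hR0 _) ((iF _ _).add (iT _)) p
    rw [integral_add' (iF _ _) (iT _), mass] at this
    linarith [tail (y-δ)]
  constructor
  · have : (a - ε0) * Isc < g y * Isc := by nlinarith [u2.1]
    have := lt_of_mul_lt_mul_right this hI.le
    linarith
  · have : g y * Isc < (a + ε0) * Isc := by nlinarith [u1.2]
    have := lt_of_mul_lt_mul_right this hI.le
    linarith

lemma g_lower {g : ℝ → ℝ} {h x₀ : ℝ} (hh : 0 < h) (hg0 : ∀ x < x₀, g x = 0)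
    (hslow : ∀ x y, x₀ ≤ x → x ≤ y → y ≤ x + h → Real.exp (x - y) * (g x - 1) ≤ g y) :
    ∃ C ≥ 0, ∀ x, -C ≤ g x := by
  have hE : 0 < Real.exp h - 1 := by
    have := Real.add_one_lt_exp hh.ne'
    linarith
  set C := max |g x₀| (1 / (Real.exp h - 1)) with hC
  have hC0 : 0 ≤ C := (abs_nonneg _).trans (le_max_left _ _)
  have hC1 : C + 1 ≤ C * Real.exp h := by
    have : 1 / (Real.exp h - 1) ≤ C := le_max_right _ _
    rw [div_le_iff₀ hE] at this
    linarith
  have hn : ∀ n : ℕ, -C ≤ g (x₀ + n * h) := by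
    intro n
    induction n with
    | zero =>
      simp only [Nat.cast_zero, zero_mul, add_zero]
      have := neg_abs_le (g x₀)
      have h2 : |g x₀| ≤ C := le_max_left _ _
      linarith
    | succ n ih =>
      have hnn : (0:ℝ) ≤ n * h := by positivity
      have := hslow (x₀ + n * h) (x₀ + (n+1:ℕ) * h) (by linarith) (by push_cast; linarith)
        (by push_cast; linarith)
      refine le_trans ?_ this
      have e : x₀ + n * h - (x₀ + (n+1:ℕ) * h) = -h := by push_cast; ring
      rw [e, Real.exp_neg]
      have : -C * Real.exp h ≤ g (x₀ + n * h) - 1 := by linarith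
      rw [inv_mul_eq_div, le_div_iff₀ (Real.exp_pos _)]
      exact this
  refine ⟨C + 1, by linarith, fun y => ?_⟩
  rcases lt_or_ge y x₀ with hy | hy
  · rw [hg0 y hy]; linarith
  · set n := ⌊(y - x₀) / h⌋₊ with hnd
    have hq : 0 ≤ (y - x₀) / h := div_nonneg (by linarith) hh.le
    have n1 : (n:ℝ) * h ≤ y - x₀ := by
      have := Nat.floor_le hq
      rwa [le_div_iff₀ hh] at this
    have n2 : y - x₀ < (n + 1) * h := by
      have := Nat.lt_floor_add_one ((y - x₀) / h)
      rwa [div_lt_iff₀ hh] at this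
    have hnn : (0:ℝ) ≤ n * h := by positivity
    have := hslow (x₀ + n * h) y (by linarith) (by linarith) (by linarith)
    refine le_trans ?_ this
    have e1 : Real.exp (x₀ + n * h - y) ≤ 1 := Real.exp_le_one_iff.mpr (by linarith)
    have e2 := Real.exp_pos (x₀ + n * h - y)
    have := hn n
    nlinarith

lemma core {g f : ℝ → ℝ} (hi : ∀ η > 0, Integrable (fun x => Real.exp (-(η * x)) * g x))
    {x₀ h : ℝ} (hx0 : 0 < x₀) (hg0 : ∀ x < x₀, g x = 0) (hh : 0 < h)
    (hslow1 : ∀ x y, x₀ ≤ x → x ≤ y → y ≤ x + h → Real.exp (x - y) * (g x - 1) ≤ g y)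
    (hslow : ∀ ε > 0, ∃ h > 0, ∃ X, ∀ x y, X ≤ x → x ≤ y → y ≤ x + h →
      Real.exp (x - y) * (g x - ε) ≤ g y)
    (hf : BdHyp g f) {r c : ℝ} (hr : 0 < r)
    (hlow : ∀ t ∈ Icc 0 r, ∀ η ∈ Ioc (0:ℝ) 1, -c ≤ uu g η t) :
    ∃ a B, (∀ x, |g x| ≤ B) ∧ Tendsto g atTop (𝓝 a) := by
  have h0 : ∀ x < 0, g x = 0 := fun x hx => hg0 x (by linarith)
  have hgm : AEStronglyMeasurable g volume := by
    have h1 := (hi 1 one_pos).aestronglyMeasurable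
    have h2 : Continuous fun x : ℝ => Real.exp (1 * x) := by fun_prop
    refine (h2.aestronglyMeasurable.mul h1).congr (Eventually.of_forall fun x => ?_)
    simp only [Pi.mul_apply]
    rw [← mul_assoc, ← Real.exp_add]; simp
  obtain ⟨C0, hC0⟩ := mass_bound hi h0 hr hlow
  have hM := mass_bound' hi hf (by positivity : 0 < r/2) hC0
  obtain ⟨C, hC, hCl⟩ := g_lower hh hg0 hslow1
  obtain ⟨M, hM1⟩ := hM 1 one_pos
  obtain ⟨B, hB⟩ := g_upper hi h0 hC hCl hh hx0.le hslow1 hM1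
  have hBB : ∀ x, |g x| ≤ max C |B| := by
    intro x
    rw [abs_le]
    constructor
    · linarith [hCl x, le_max_left C |B|]
    · rcases lt_or_ge x x₀ with hx | hx
      · rw [hg0 x hx]; exact hC.trans (le_max_left _ _)
      · exact (hB x hx).trans ((le_abs_self _).trans (le_max_right _ _))
  obtain ⟨A, hA⟩ := J_asymp hi h0 hBB hf hM
  refine ⟨2 * A / Isc, _, hBB, tauber hgm hBB (fun R hR => ?_) hslow⟩
  rw [div_mul_cancel₀ _ Isc_pos.ne']
  exact G_asymp hgm h0 hBB (by linarith) (hA R hR)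

lemma abel {g : ℝ → ℝ} (hi : ∀ η > 0, Integrable (fun x => Real.exp (-(η * x)) * g x))
    (h0 : ∀ x < 0, g x = 0) {a B : ℝ} (hB : ∀ x, |g x| ≤ B) (ha : Tendsto g atTop (𝓝 a)) :
    Tendsto (fun η => η * ∫ x, Real.exp (-(η * x)) * g x) (𝓝[>] 0) (𝓝 a) := by
  have hB0 : 0 ≤ B := (abs_nonneg _).trans (hB 0)
  have e1 : ∀ η > 0, η * ∫ x, Real.exp (-(η * x)) * g x = ∫ v, Real.exp (-v) * g (η⁻¹ * v) := by
    intro η hη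
    have := Measure.integral_comp_mul_left (fun x => Real.exp (-(η * x)) * g x) η⁻¹
    rw [inv_inv, abs_of_pos hη, smul_eq_mul] at this
    rw [← this]
    congr 1; ext v
    rw [← mul_assoc, mul_inv_cancel₀ hη.ne', one_mul]
  have hexp : Integrable ((Ioi (0:ℝ)).indicator fun v => Real.exp (-v)) :=
    (integrable_indicator_iff measurableSet_Ioi).mpr (integrableOn_exp_neg_Ioi 0)
  have lim : Tendsto (fun η => ∫ v, Real.exp (-v) * g (η⁻¹ * v)) (𝓝[>] 0)
      (𝓝 (∫ v, a * (Ioi (0:ℝ)).indicator (fun v => Real.exp (-v)) v)) := by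
    refine tendsto_integral_filter_of_dominated_convergence
      (fun v => B * (Ioi (0:ℝ)).indicator (fun v => Real.exp (-v)) v) ?_ ?_ (hexp.const_mul B) ?_
    · filter_upwards [self_mem_nhdsWithin] with η hη
      have hη : 0 < η := hη
      have := (hi η hη).comp_mul_left' (R := η⁻¹) (by positivity)
      refine this.aestronglyMeasurable.congr (Eventually.of_forall fun v => ?_)
      simp only
      rw [← mul_assoc, mul_inv_cancel₀ hη.ne', one_mul]
    · filter_upwards [self_mem_nhdsWithin] with η hη
      have hη : 0 < η := hη
      filter_upwards [Measure.ae_ne volume (0:ℝ)] with v hv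
      rcases lt_or_gt_of_ne hv with hv | hv
      · rw [h0 _ (mul_neg_of_pos_of_neg (by positivity) hv), indicator_of_notMem (by simp [hv.le])]
        simp
      · rw [indicator_of_mem (by exact hv), norm_mul, Real.norm_eq_abs, Real.norm_eq_abs,
          Real.abs_exp, mul_comm]
        exact mul_le_mul_of_nonneg_right (hB _) (Real.exp_pos _).le
    · filter_upwards [Measure.ae_ne volume (0:ℝ)] with v hv
      rcases lt_or_gt_of_ne hv with hv | hv
      · rw [indicator_of_notMem (by simp [hv.le])]
        refine (tendsto_const_nhds (x := (a * 0))).congr' ?_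
        filter_upwards [self_mem_nhdsWithin] with η hη
        have hη : 0 < η := hη
        rw [h0 _ (mul_neg_of_pos_of_neg (by positivity) hv)]; simp
      · rw [indicator_of_mem (by exact hv), mul_comm]
        apply Tendsto.const_mul
        exact ha.comp (tendsto_inv_nhdsGT_zero.atTop_mul_const hv)
  rw [integral_const_mul, integral_indicator measurableSet_Ioi, integral_exp_neg_Ioi_zero,
    mul_one] at lim
  refine lim.congr' ?_
  filter_upwards [self_mem_nhdsWithin] with η hη
  exact (e1 η hη).symm

/-- Theorem 1.2 (B.1): Wiener–Ikehara theorem with a one-sided boundedness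
assumption on the real part of the Laplace transform near `s = 1`. -/
theorem wiener_ikehara_B1 (S : ℝ → ℝ)
    (hS : LocallyIntegrableOn S (Ici 0))
    (hslow : LogLinSlowlyDecreasing S)
    (hconv : ∀ s : ℂ, 1 < s.re →
      IntegrableOn (fun x : ℝ => Complex.exp (-s * x) * (S x : ℂ)) (Ioi 0))
    (U : ℂ → ℝ) (hU : ∀ s : ℂ, U s = (laplaceT S s).re)
    (hbd : L1locBoundaryBehavior U)
    (lam c : ℝ) (hlam : 0 < lam) (hc : 0 ≤ c)
    (hlow : ∀ t ∈ Ioo (-lam) lam, ∀ σ ∈ Ioc (1 : ℝ) 2,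
      -c ≤ U (σ + t * Complex.I)) :
    ∃ a : ℝ,
      Tendsto (fun σ : ℝ => (σ - 1) * U σ) (nhdsWithin 1 (Ioi 1)) (nhds a) ∧
      Tendsto (fun x : ℝ => Real.exp (-x) * S x) atTop (nhds a) := by
  obtain ⟨h, hh, x₀, hx0, hsl⟩ := hslow 1 one_pos
  set τ : ℝ → ℝ := fun x => Real.exp (-x) * S x with hτ
  set g : ℝ → ℝ := (Ici x₀).indicator τ with hg
  set p : ℝ → ℝ := (Ioo 0 x₀).indicator τ with hp
  have hg0 : ∀ x < x₀, g x = 0 := fun x hx => indicator_of_notMem (by simpa using hx) _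
  have hg1 : ∀ x ≥ x₀, g x = τ x := fun x hx => indicator_of_mem (by exact hx) _
  have hp0 : ∀ x, x ∉ Ioo 0 x₀ → p x = 0 := fun x hx => indicator_of_notMem hx _
  have hτi : ∀ η > 0, IntegrableOn (fun x => Real.exp (-(η * x)) * τ x) (Ioi 0) := by
    intro η hη
    have := (hconv ((1 + η : ℝ) : ℂ) (by simpa using hη)).re
    refine this.congr (Eventually.of_forall fun x => ?_)
    simp only [hτ]
    rw [← mul_assoc, ← Real.exp_add]
    have : Complex.exp (-((1 + η : ℝ) : ℂ) * x) * (S x : ℂ)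
        = ((Real.exp (-(η * x) + -x) * S x : ℝ) : ℂ) := by
      push_cast; congr 2; ring
    rw [this]
    exact Complex.ofReal_re _
  have hi : ∀ η > 0, Integrable (fun x => Real.exp (-(η * x)) * g x) := by
    intro η hη
    have := (integrable_indicator_iff measurableSet_Ici).mpr
      ((hτi η hη).mono_set (Ici_subset_Ioi.mpr hx0))
    refine this.congr (Eventually.of_forall fun x => ?_)
    by_cases hx : x ∈ Ici x₀ <;> simp [hg, hx]
  have hpi : Integrable p := by
    rw [hp, integrable_indicator_iff measurableSet_Ioo]
    have h1 : IntegrableOn S (Icc 0 x₀) :=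
      hS.integrableOn_compact_subset Icc_subset_Ici_self isCompact_Icc
    have h2 := h1.continuousOn_mul (g := fun x : ℝ => Real.exp (-x))
      (by fun_prop : Continuous _).continuousOn isCompact_Icc
    exact h2.mono_set Ioo_subset_Icc_self
  have hpei : ∀ η > 0, Integrable (fun x => Real.exp (-(η * x)) * p x) := by
    intro η hη
    have := (integrable_indicator_iff measurableSet_Ioo).mpr
      ((hτi η hη).mono_set (fun x (hx : x ∈ Ioo 0 x₀) => hx.1))
    refine this.congr (Eventually.of_forall fun x => ?_)
    by_cases hx : x ∈ Ioo 0 x₀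
    · rw [indicator_of_mem hx, hp]; beta_reduce; rw [indicator_of_mem hx]
    · rw [indicator_of_notMem hx, hp]; beta_reduce; rw [indicator_of_notMem hx, mul_zero]
  have hUu : ∀ η > 0, ∀ t : ℝ, U (((1 + η : ℝ) : ℂ) + t * Complex.I) = uu g η t + uu p η t := by
    intro η hη t
    have hs := hconv (((1 + η : ℝ) : ℂ) + t * Complex.I) (by simpa using hη)
    rw [hU, laplaceT]
    have e1 : (∫ x in Ioi (0:ℝ), Complex.exp (-(((1 + η : ℝ) : ℂ) + t * Complex.I) * x) * (S x : ℂ)).re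
      = ∫ x in Ioi (0:ℝ), (Complex.exp (-(((1 + η : ℝ) : ℂ) + t * Complex.I) * x) * (S x : ℂ)).re :=
      (integral_re hs).symm
    rw [e1]
    unfold uu cosT
    rw [← integral_add (cosT_integrable (hi η hη) t) (cosT_integrable (hpei η hη) t),
      ← integral_indicator measurableSet_Ioi]
    congr 1; ext x
    rcases le_or_gt x 0 with hx | hx
    · rw [indicator_of_notMem (by simpa using hx), hg0 x (by linarith),
        hp0 x (fun h => by linarith [h.1])]
      simp
    · rw [indicator_of_mem (by exact hx)]
      have e2 : g x + p x = τ x := by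
        rcases lt_or_ge x x₀ with hx1 | hx1
        · rw [hg0 x hx1, hp, indicator_of_mem (show x ∈ Ioo 0 x₀ from ⟨hx, hx1⟩), zero_add]
        · rw [hg1 x hx1, hp0 x (fun h => by linarith [h.2]), add_zero]
      have e3 : Real.exp (-(η * x)) * g x * Real.cos (t * x) + Real.exp (-(η * x)) * p x * Real.cos (t * x)
          = Real.exp (-(η * x)) * (g x + p x) * Real.cos (t * x) := by ring
      rw [e3, e2, Complex.re_mul_ofReal, Complex.exp_re]
      simp only [hτ]
      have r1 : (-(((1 + η : ℝ) : ℂ) + t * Complex.I) * x).re = -(η * x) + -x := by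
        simp; ring
      have r2 : (-(((1 + η : ℝ) : ℂ) + t * Complex.I) * x).im = -(t * x) := by
        simp
      rw [r1, r2, Real.cos_neg, Real.exp_add]
      ring
  set P := ∫ x, |p x| with hP
  have hP0 : 0 ≤ P := integral_nonneg fun x => abs_nonneg _
  have hpb : ∀ η > 0, ∀ t, |uu p η t| ≤ P := by
    intro η hη t
    unfold uu cosT
    rw [← Real.norm_eq_abs]
    refine norm_integral_le_of_norm_le hpi.abs (Eventually.of_forall fun x => ?_)
    by_cases hx : x ∈ Ioo 0 x₀
    · rw [Real.norm_eq_abs, abs_mul, abs_mul, Real.abs_exp]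
      have e1 : Real.exp (-(η*x)) ≤ 1 := Real.exp_le_one_iff.mpr (by
        have := mul_pos hη hx.1; linarith)
      refine (mul_le_of_le_one_right (by positivity) (Real.abs_cos_le_one _)).trans ?_
      exact mul_le_of_le_one_left (abs_nonneg _) e1
    · have q := hp0 x hx
      simp [q]
  have hpd : ∀ η > 0, ∀ t, |uu p η t - cosT p t| ≤ η * x₀ * P := by
    intro η hη t
    unfold uu cosT
    rw [← integral_sub (cosT_integrable (hpei η hη) t) (cosT_integrable hpi t), hP,
      ← integral_const_mul, ← Real.norm_eq_abs]
    refine norm_integral_le_of_norm_le (hpi.abs.const_mul _) (Eventually.of_forall fun x => ?_)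
    by_cases hx : x ∈ Ioo 0 x₀
    · have e1 : Real.exp (-(η*x)) ≤ 1 := Real.exp_le_one_iff.mpr (by
        have := mul_pos hη hx.1; linarith)
      have e2 := Real.add_one_le_exp (-(η*x))
      have e3 : η * x ≤ η * x₀ := mul_le_mul_of_nonneg_left hx.2.le hη.le
      have e4 : |Real.exp (-(η*x)) - 1| ≤ η * x₀ := by
        rw [abs_le]; constructor <;> linarith [mul_pos hη hx0]
      have e5 : Real.exp (-(η * x)) * p x * Real.cos (t * x) - p x * Real.cos (t * x)
        = (Real.exp (-(η*x)) - 1) * p x * Real.cos (t*x) := by ring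
      rw [Real.norm_eq_abs, e5, abs_mul, abs_mul]
      refine (mul_le_of_le_one_right (by positivity) (Real.abs_cos_le_one _)).trans ?_
      exact mul_le_mul_of_nonneg_right e4 (abs_nonneg _)
    · rw [hp0 x hx]; simp
  have shift : Tendsto (fun η : ℝ => 1 + η) (𝓝[>] 0) (𝓝[>] 1) := by
    apply tendsto_nhdsWithin_of_tendsto_nhds_of_eventually_within
    · have : Continuous fun η : ℝ => 1 + η := by fun_prop
      have := this.tendsto 0
      simp only [add_zero] at this
      exact this.mono_left nhdsWithin_le_nhds
    · filter_upwards [self_mem_nhdsWithin] with η hη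
      have hη : 0 < η := hη
      simpa using hη
  have shift' : Tendsto (fun σ : ℝ => σ - 1) (𝓝[>] 1) (𝓝[>] 0) := by
    apply tendsto_nhdsWithin_of_tendsto_nhds_of_eventually_within
    · have : Continuous fun σ : ℝ => σ - 1 := by fun_prop
      have := this.tendsto 1
      simp only [sub_self] at this
      exact this.mono_left nhdsWithin_le_nhds
    · filter_upwards [self_mem_nhdsWithin] with η hη
      have hη : 1 < η := hη
      simpa using hη
  obtain ⟨f, hf⟩ := hbd
  have hpc : Continuous (cosT p) := cosT_continuous hpi
  have hBd : BdHyp g (fun t => f t - cosT p t) := by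
    intro a b ha hab
    obtain ⟨f1, f2⟩ := hf a b hab (fun h => by linarith [h.1])
    refine ⟨f1.sub hpc.continuousOn.integrableOn_Icc, ?_⟩
    have f1' : IntervalIntegrable f volume a b := by
      rw [intervalIntegrable_iff_integrableOn_Icc_of_le hab]; exact f1
    have l1 := f2.comp shift
    have l2 : Tendsto (fun η : ℝ => (b - a) * (η * x₀ * P)) (𝓝[>] 0) (𝓝 0) := by
      have : Continuous fun η : ℝ => (b - a) * (η * x₀ * P) := by fun_prop
      have := this.tendsto 0
      simp only [zero_mul, mul_zero] at this
      exact this.mono_left nhdsWithin_le_nhds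
    have l3 := l1.add l2
    rw [add_zero] at l3
    refine squeeze_zero' (Eventually.of_forall fun η =>
      intervalIntegral.integral_nonneg hab (fun t _ => abs_nonneg _)) ?_ l3
    filter_upwards [self_mem_nhdsWithin] with η hη
    have hη : 0 < η := hη
    simp only [Function.comp]
    have cg : Continuous (uu g η) := cosT_continuous (hi η hη)
    have cp : Continuous (uu p η) := cosT_continuous (hpei η hη)
    simp_rw [hUu η hη]
    have i1 : IntervalIntegrable (fun t => |uu g η t + uu p η t - f t|) volume a b :=
      (((cg.add cp).intervalIntegrable _ _).sub f1').abs
    have e : (b - a) * (η * x₀ * P) = ∫ t in a..b, η * x₀ * P := by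
      rw [intervalIntegral.integral_const, smul_eq_mul]
    rw [e, ← intervalIntegral.integral_add i1 (by simp)]
    apply intervalIntegral.integral_mono_on hab
    · exact ((cg.intervalIntegrable _ _).sub (f1'.sub (hpc.intervalIntegrable _ _))).abs
    · exact i1.add (by simp)
    · intro t _
      have e1 : uu g η t - (f t - cosT p t) = (uu g η t + uu p η t - f t) + -(uu p η t - cosT p t) := by
        ring
      rw [e1]
      refine (abs_add_le _ _).trans ?_
      rw [abs_neg]
      linarith [hpd η hη t]
  have slowτ : ∀ ε X h : ℝ, (∀ x y : ℝ, X ≤ x → x ≤ y → y ≤ x + h → (S y - S x) / Real.exp x ≥ -ε) →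
      ∀ x y, max X x₀ ≤ x → x ≤ y → y ≤ x + h → Real.exp (x - y) * (g x - ε) ≤ g y := by
    intro ε X h hX x y h1 h2 h3
    have k := hX x y ((le_max_left _ _).trans h1) h2 h3
    have hx : x₀ ≤ x := (le_max_right _ _).trans h1
    rw [hg1 x hx, hg1 y (hx.trans h2)]
    rw [ge_iff_le, le_div_iff₀ (Real.exp_pos _)] at k
    simp only [hτ]
    have e : Real.exp (x - y) * (Real.exp (-x) * S x - ε)
        = Real.exp (-y) * (S x - ε * Real.exp x) := by
      have e1 : Real.exp (x - y) = Real.exp (-y) * Real.exp x := by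
        rw [← Real.exp_add]; ring_nf
      have e2 : Real.exp x * Real.exp (-x) = 1 := by rw [← Real.exp_add]; simp
      rw [e1]
      linear_combination Real.exp (-y) * S x * e2
    rw [e]
    apply mul_le_mul_of_nonneg_left _ (Real.exp_pos _).le
    linarith
  have hlow' : ∀ t ∈ Icc 0 (lam/2), ∀ η ∈ Ioc (0:ℝ) 1, -(c + P) ≤ uu g η t := by
    intro t ht η hη
    have k := hlow t ⟨by linarith [ht.1], by linarith [ht.2]⟩ (1 + η)
      ⟨by linarith [hη.1], by linarith [hη.2]⟩
    rw [hUu η hη.1] at k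
    have := (abs_le.mp (hpb η hη.1 t)).2
    linarith
  obtain ⟨a, B, hB, ha⟩ := core hi hx0 hg0 hh
    (fun x y h1 => slowτ 1 x₀ h hsl x y (by simpa using h1))
    (fun ε hε => by
      obtain ⟨h', hh', X, _, hX⟩ := hslow ε hε
      exact ⟨h', hh', max X x₀, slowτ ε X h' hX⟩) hBd (by positivity : 0 < lam/2) hlow'
  refine ⟨a, ?_, ?_⟩
  · have l1 := abel hi (fun x hx => hg0 x (by linarith)) hB ha
    have l2 : Tendsto (fun η : ℝ => η * uu p η 0) (𝓝[>] 0) (𝓝 0) := by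
      have l3 : Tendsto (fun η : ℝ => η * P) (𝓝[>] 0) (𝓝 0) := by
        have : Continuous fun η : ℝ => η * P := by fun_prop
        have := this.tendsto 0
        simp only [zero_mul] at this
        exact this.mono_left nhdsWithin_le_nhds
      refine squeeze_zero_norm' ?_ l3
      filter_upwards [self_mem_nhdsWithin] with η hη
      have hη : 0 < η := hη
      rw [norm_mul, Real.norm_eq_abs, Real.norm_eq_abs, abs_of_pos hη]
      exact mul_le_mul_of_nonneg_left (hpb η hη 0) hη.le
    have l3 := (l1.add l2).comp shift'
    rw [add_zero] at l3
    refine l3.congr' ?_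
    filter_upwards [self_mem_nhdsWithin] with σ hσ
    have hσ : 1 < σ := hσ
    have k := hUu (σ - 1) (by linarith) 0
    have e : (((1 + (σ - 1) : ℝ) : ℂ) + (0:ℝ) * Complex.I) = (σ : ℂ) := by simp
    rw [e] at k
    simp only [Function.comp]
    rw [k, mul_add]
    congr 2
    simp [uu, cosT]
  · refine ha.congr' ?_
    filter_upwards [eventually_ge_atTop x₀] with x hx
    exact hg1 x hx
end

section
/- Let S ∈ L¹_loc[0,∞) be log-linearly slowly decreasing, with Laplace transform 𝓛{S;s} = ∫₀^∞ e^{−sx} S(x) dx convergent for every complex s with Re s > 1, and set U(s) = Re 𝓛{S;s}. Assume U has L¹_loc-boundary behavior on 1 + i(ℝ∖{0}), and assume there exists λ > 0 such that sup_{1<σ<2} ∫_{−λ}^{λ} |U(σ+it)| dt < ∞. Then the limit a = lim_{σ→1⁺} (σ−1) U(σ) exists and S(x) ∼ a e^x as x → ∞, i.e. lim_{x→∞} e^{−x} S(x) = a. -/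
open MeasureTheory Filter Set

noncomputable def wk (x : ℝ) : ℝ := (Real.sinc (x / 2)) ^ 2 / 2
noncomputable def wphi (L t : ℝ) : ℝ := max (1 - t / L) 0

lemma wk_cont : Continuous wk := by
  unfold wk
  have := Real.continuous_sinc
  fun_prop

lemma wk_nonneg (x : ℝ) : 0 ≤ wk x := by unfold wk; positivity

lemma wk_mul (x : ℝ) : x ^ 2 * wk x = 1 - Real.cos x := by
  by_cases hx : x = 0
  · simp [hx]
  · unfold wk
    rw [Real.sinc_of_ne_zero (by simpa using hx)]
    have := Real.cos_sq (x/2)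
    have h2 := Real.sin_sq_add_cos_sq (x/2)
    rw [show 2 * (x/2) = x by ring] at this
    field_simp
    linarith

lemma wk_zero : wk 0 = 1 / 2 := by simp [wk]

lemma wk_le_half (x : ℝ) : wk x ≤ 1 / 2 := by
  unfold wk
  have : |Real.sinc (x/2)| ≤ 1 := by
    rw [abs_le]; exact ⟨Real.neg_one_le_sinc _, Real.sinc_le_one _⟩
  have := (sq_le_one_iff_abs_le_one _).2 this
  linarith

lemma wk_le (x : ℝ) : wk x ≤ 4 * (1 + x ^ 2)⁻¹ := by
  have h1 := wk_mul x
  have h2 := wk_le_half x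
  have h3 := Real.neg_one_le_cos x
  rw [← div_eq_mul_inv, le_div_iff₀ (by positivity)]
  nlinarith

lemma wk_int : Integrable wk := by
  refine (integrable_inv_one_add_sq.const_mul 4).mono' wk_cont.aestronglyMeasurable ?_
  filter_upwards with x
  rw [Real.norm_of_nonneg (wk_nonneg x)]
  exact wk_le x

lemma wk_I_pos : 0 < ∫ x, wk x :=
  integral_pos_of_integrable_nonneg_nonzero (x := 0) wk_cont wk_int wk_nonneg (by rw [wk_zero]; norm_num)

lemma wphi_cont (L : ℝ) : Continuous (wphi L) := by unfold wphi; fun_prop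
lemma wphi_nonneg (L t : ℝ) : 0 ≤ wphi L t := le_max_right _ _
lemma wphi_le_one {L t : ℝ} (hL : 0 < L) (ht : 0 ≤ t) : wphi L t ≤ 1 := by
  unfold wphi
  have : 0 ≤ t / L := by positivity
  exact max_le (by linarith) (by norm_num)
lemma wphi_zero (L : ℝ) : wphi L 0 = 1 := by simp [wphi]

lemma wphi_hat {L N : ℝ} (hL : 0 < L) (hN : L ≤ N) (x : ℝ) :
    ∫ t in (0:ℝ)..N, wphi L t * Real.cos (t * x) = L * wk (L * x) := by
  have hc : Continuous fun t => wphi L t * Real.cos (t * x) := by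
    have := wphi_cont L; fun_prop
  rw [← intervalIntegral.integral_add_adjacent_intervals (b := L) (hc.intervalIntegrable _ _) (hc.intervalIntegrable _ _)]
  have h2 : ∫ t in L..N, wphi L t * Real.cos (t * x) = 0 := by
    rw [intervalIntegral.integral_congr (g := fun _ => 0)]
    · simp
    · intro t ht
      rw [uIcc_of_le hN] at ht
      have : 1 ≤ t / L := by rw [le_div_iff₀ hL]; linarith [ht.1]
      simp only [wphi]
      rw [max_eq_right (by linarith)]; simp
  have h1 : ∫ t in (0:ℝ)..L, wphi L t * Real.cos (t * x) = ∫ t in (0:ℝ)..L, (1 - t / L) * Real.cos (t * x) := by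
    apply intervalIntegral.integral_congr
    intro t ht
    rw [uIcc_of_le hL.le] at ht
    have : t / L ≤ 1 := by rw [div_le_iff₀ hL]; linarith [ht.2]
    simp only [wphi]
    rw [max_eq_left (by linarith)]
  rw [h1, h2, add_zero]
  by_cases hx : x = 0
  · subst hx
    simp only [mul_zero, Real.cos_zero, mul_one, wk_zero]
    rw [intervalIntegral.integral_sub (by simp) (by apply Continuous.intervalIntegrable; fun_prop)]
    rw [intervalIntegral.integral_div, integral_id]
    simp; field_simp; ring
  · rw [intervalIntegral.integral_eq_sub_of_hasDerivAt (f := fun t => (1 - t / L) * Real.sin (t * x) / x - Real.cos (t * x) / (L * x^2))]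
    · have := wk_mul (L * x)
      have h3 : wk (L * x) = (1 - Real.cos (L * x)) / (L * x)^2 := by
        rw [← this]; field_simp
      rw [h3]; simp; field_simp; ring
    · intro t _
      have e1 : HasDerivAt (fun t => 1 - t / L) (-(1/L)) t := by
        simpa using ((hasDerivAt_id t).div_const L).const_sub 1
      have e0 : HasDerivAt (fun t => t * x) x t := by simpa using (hasDerivAt_id t).mul_const x
      have e2 := e0.sin
      have e3 := e0.cos
      have := ((e1.mul e2).div_const x).sub (e3.div_const (L*x^2))
      refine HasDerivAt.congr_deriv this ?_
      field_simp; ring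
    · apply Continuous.intervalIntegrable; fun_prop

/-- Laplace cosine transform. -/
noncomputable def wV (g : ℝ → ℝ) (δ t : ℝ) : ℝ :=
  ∫ x in Ioi (0:ℝ), (Real.exp (-δ * x) * g x) * Real.cos (t * x)

/-- symmetrized kernel -/
noncomputable def wK (L h x : ℝ) : ℝ := (L * wk (L * (x - h)) + L * wk (L * (x + h))) / 2

lemma wK_cont (L h : ℝ) : Continuous (wK L h) := by
  unfold wK
  have := wk_cont
  fun_prop

lemma wK_nonneg {L : ℝ} (hL : 0 < L) (h x : ℝ) : 0 ≤ wK L h x := by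
  unfold wK
  have := wk_nonneg (L * (x - h))
  have := wk_nonneg (L * (x + h))
  positivity

lemma wK_le {L : ℝ} (hL : 0 < L) (h x : ℝ) : wK L h x ≤ L / 2 := by
  unfold wK
  have := wk_le_half (L * (x - h))
  have := wk_le_half (L * (x + h))
  nlinarith

lemma wk_shift_int {L : ℝ} (hL : 0 < L) (h : ℝ) : Integrable (fun x => L * wk (L * (x - h))) := by
  have := ((wk_int.comp_mul_left' hL.ne').comp_sub_right h).const_mul L
  simpa using this

lemma wk_shift_integral {L : ℝ} (hL : 0 < L) (h : ℝ) : ∫ x, L * wk (L * (x - h)) = ∫ x, wk x := by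
  rw [integral_const_mul, integral_sub_right_eq_self (fun x => wk (L * x)) h,
    Measure.integral_comp_mul_left]
  simp [abs_of_pos hL]
  field_simp

lemma wK_eq (L h : ℝ) : wK L h = fun x => (L * wk (L * (x - h)) + L * wk (L * (x - (-h)))) / 2 := by
  funext x; simp [wK]

lemma wK_int {L : ℝ} (hL : 0 < L) (h : ℝ) : Integrable (wK L h) := by
  rw [wK_eq]
  exact ((wk_shift_int hL h).add (wk_shift_int hL (-h))).div_const 2

lemma wK_integral {L : ℝ} (hL : 0 < L) (h : ℝ) : ∫ x, wK L h x = ∫ x, wk x := by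
  rw [wK_eq, integral_div, integral_add (wk_shift_int hL h) (wk_shift_int hL (-h)), wk_shift_integral hL, wk_shift_integral hL]
  ring

lemma wphi_hat2 {L N : ℝ} (hL : 0 < L) (hN : L ≤ N) (h x : ℝ) :
    ∫ t in (0:ℝ)..N, (wphi L t * Real.cos (h * t)) * Real.cos (t * x) = wK L h x := by
  unfold wK
  rw [← wphi_hat hL hN, ← wphi_hat hL hN, ← intervalIntegral.integral_add, ← intervalIntegral.integral_div]
  · congr 1; funext t
    have e1 : t * (x - h) = t * x - h * t := by ring
    have e2 : t * (x + h) = t * x + h * t := by ring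
    rw [e1, e2, Real.cos_sub, Real.cos_add]; ring
  all_goals
    apply Continuous.intervalIntegrable
    have := wphi_cont L
    fun_prop

lemma wV_cont {g : ℝ → ℝ} {δ : ℝ}
    (hg : IntegrableOn (fun x => Real.exp (-δ * x) * g x) (Ioi 0)) : Continuous (wV g δ) := by
  unfold wV
  refine continuous_of_dominated (bound := fun x => ‖Real.exp (-δ * x) * g x‖) ?_ ?_ hg.norm ?_
  · intro t
    exact hg.aestronglyMeasurable.mul (by fun_prop)
  · intro t
    filter_upwards with x
    rw [norm_mul]
    exact mul_le_of_le_one_right (norm_nonneg _) (Real.abs_cos_le_one _)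
  · filter_upwards with x
    fun_prop

lemma wV_fubini {g : ℝ → ℝ} {δ : ℝ}
    (hg : IntegrableOn (fun x => Real.exp (-δ * x) * g x) (Ioi 0)) {L N : ℝ} (hL : 0 < L) (hN : L ≤ N)
    (h : ℝ) :
    ∫ t in (0:ℝ)..N, wV g δ t * (wphi L t * Real.cos (h * t)) =
      ∫ x in Ioi (0:ℝ), (Real.exp (-δ * x) * g x) * wK L h x := by
  have hN0 : 0 ≤ N := hL.le.trans hN
  rw [intervalIntegral.integral_of_le hN0]
  simp only [wV, ← integral_mul_const]
  rw [integral_integral_swap]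
  · congr 1; funext x
    rw [← wphi_hat2 hL hN, intervalIntegral.integral_of_le hN0, ← integral_const_mul]
    congr 1; funext t; ring
  · have h1 : Integrable (fun t => wphi L t * Real.cos (h * t)) (volume.restrict (Ioc 0 N)) := by
      have : Continuous (fun t => wphi L t * Real.cos (h * t)) := by
        have := wphi_cont L
        fun_prop
      exact (this.integrableOn_Icc (a := 0) (b := N)).mono_set Ioc_subset_Icc_self
    have h2 := h1.mul_prod hg
    have h3 := h2.mul_bdd (g := fun p : ℝ × ℝ => Real.cos (p.1 * p.2)) (c := 1)
      (by fun_prop) (by filter_upwards with p; exact Real.abs_cos_le_one _)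
    refine h3.congr ?_
    filter_upwards with p
    simp only [Function.uncurry]
    ring

lemma key_int {V : ℝ → ℝ → ℝ} (hV : ∀ δ, 0 < δ → Continuous (V δ)) {f : ℝ → ℝ}
    (hf : ∀ ε N, 0 < ε → ε ≤ N → IntegrableOn f (Icc ε N) ∧
      Tendsto (fun δ => ∫ t in ε..N, |V δ t - f t|) (nhdsWithin 0 (Ioi 0)) (nhds 0))
    {lam M : ℝ} (hlam : 0 < lam) (hM : ∀ δ ∈ Ioo (0:ℝ) 1, ∫ t in (0:ℝ)..lam, |V δ t| ≤ M) (N : ℝ) :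
    IntegrableOn f (Ioc 0 N) := by
  have h1 : IntegrableOn f (Ioc 0 lam) := by
    have ha : ∀ n : ℕ, 0 < lam * (1 / ((n:ℝ) + 1)) ∧ lam * (1 / ((n:ℝ) + 1)) ≤ lam := by
      intro n
      refine ⟨by positivity, ?_⟩
      apply mul_le_of_le_one_right hlam.le
      rw [div_le_one (by positivity)]
      linarith [(Nat.cast_nonneg n : (0:ℝ) ≤ n)]
    refine integrableOn_Ioc_of_intervalIntegral_norm_bounded_left (l := atTop) (I := M)
      (a := fun n : ℕ => lam * (1 / ((n:ℝ) + 1))) ?_ ?_ ?_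
    · intro n
      exact ((hf _ lam (ha n).1 (ha n).2).1).mono_set Ioc_subset_Icc_self
    · simpa using (tendsto_one_div_add_atTop_nhds_zero_nat (𝕜 := ℝ)).const_mul lam
    · filter_upwards with n
      obtain ⟨h0, h2⟩ := ha n
      set ε := lam * (1 / ((n:ℝ) + 1))
      obtain ⟨hi, ht⟩ := hf ε lam h0 h2
      rw [← intervalIntegral.integral_of_le h2]
      have ht' := ht.add_const M
      rw [zero_add] at ht'
      refine ge_of_tendsto ht' ?_
      filter_upwards [Ioo_mem_nhdsGT (show (0:ℝ) < 1 by norm_num)] with δ hδ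
      have hc := hV δ hδ.1
      have hfi : IntervalIntegrable f volume ε lam :=
        (intervalIntegrable_iff_integrableOn_Icc_of_le h2).2 hi
      have hvi : ∀ a b, IntervalIntegrable (V δ) volume a b := fun a b => hc.intervalIntegrable a b
      calc ∫ t in ε..lam, ‖f t‖ ≤ ∫ t in ε..lam, (|V δ t - f t| + |V δ t|) := by
            apply intervalIntegral.integral_mono_on h2 hfi.norm
            · exact (((hvi _ _).sub hfi).abs).add (hvi _ _).abs
            · intro t _
              rw [Real.norm_eq_abs]
              have := abs_sub_abs_le_abs_sub (f t) (V δ t)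
              rw [abs_sub_comm] at this
              linarith
        _ = (∫ t in ε..lam, |V δ t - f t|) + ∫ t in ε..lam, |V δ t| :=
            intervalIntegral.integral_add (((hvi _ _).sub hfi).abs) (hvi _ _).abs
        _ ≤ (∫ t in ε..lam, |V δ t - f t|) + M := by
            gcongr
            refine le_trans ?_ (hM δ hδ)
            apply intervalIntegral.integral_mono_interval h0.le h2 le_rfl
            · filter_upwards with t using abs_nonneg _
            · exact (hvi _ _).abs
  by_cases hN : N ≤ lam
  · exact h1.mono_set (Ioc_subset_Ioc_right hN)
  · push Not at hN
    refine (h1.union (hf lam N hlam hN.le).1).mono_set ?_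
    intro t ht
    rcases le_total t lam with h | h
    · exact Or.inl ⟨ht.1, h⟩
    · exact Or.inr ⟨h, ht.2⟩

lemma key_tendsto {V : ℝ → ℝ → ℝ} (hV : ∀ δ, 0 < δ → Continuous (V δ)) {f : ℝ → ℝ}
    (hf : ∀ ε N, 0 < ε → ε ≤ N → IntegrableOn f (Icc ε N) ∧
      Tendsto (fun δ => ∫ t in ε..N, |V δ t - f t|) (nhdsWithin 0 (Ioi 0)) (nhds 0))
    {lam M : ℝ} (hlam : 0 < lam) (hM : ∀ δ ∈ Ioo (0:ℝ) 1, ∫ t in (0:ℝ)..lam, |V δ t| ≤ M) {N : ℝ}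
    (hN : 0 < N) {ψ : ℝ → ℝ} (hψ : Continuous ψ) (hψ0 : ψ 0 = 0) :
    Tendsto (fun δ => ∫ t in (0:ℝ)..N, V δ t * ψ t) (nhdsWithin 0 (Ioi 0))
      (nhds (∫ t in (0:ℝ)..N, f t * ψ t)) := by
  have hfi := key_int hV hf hlam hM
  have hfi2 : ∀ b, 0 ≤ b → IntervalIntegrable f volume 0 b := fun b hb =>
    (intervalIntegrable_iff_integrableOn_Ioc_of_le hb).2 (hfi b)
  have hM0 : 0 ≤ M := le_trans
    (intervalIntegral.integral_nonneg hlam.le (fun t _ => abs_nonneg _)) (hM (1/2) (by norm_num))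
  set Mf := ∫ t in (0:ℝ)..N, |f t|
  have hMf : 0 ≤ Mf := intervalIntegral.integral_nonneg hN.le (fun t _ => abs_nonneg _)
  obtain ⟨C, hC⟩ := (isCompact_Icc (a := (0:ℝ)) (b := N)).exists_bound_of_continuousOn hψ.continuousOn
  have hC0 : 0 ≤ C := (norm_nonneg _).trans (hC 0 ⟨le_rfl, hN.le⟩)
  rw [Metric.tendsto_nhds]
  intro e he
  set e1 := e / (2 * (M + Mf + 1)) with he1
  have he1p : 0 < e1 := by positivity
  have hcont : ∀ᶠ t in nhds (0:ℝ), |ψ t| < e1 := by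
    have : Tendsto (fun t => |ψ t|) (nhds 0) (nhds |ψ 0|) := hψ.abs.continuousAt
    rw [hψ0, abs_zero] at this
    exact this.eventually (gt_mem_nhds he1p)
  obtain ⟨r, hr, hr2⟩ := Metric.eventually_nhds_iff.1 hcont
  set ε := min (r/2) (min lam N) with hε
  have hε0 : 0 < ε := by positivity
  have hεl : ε ≤ lam := (min_le_right _ _).trans (min_le_left _ _)
  have hεN : ε ≤ N := (min_le_right _ _).trans (min_le_right _ _)
  have hεr : ε < r := lt_of_le_of_lt (min_le_left _ _) (by linarith)
  have hsm : ∀ t ∈ Icc 0 ε, |ψ t| ≤ e1 := by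
    intro t ht
    apply (hr2 _).le
    rw [Real.dist_eq, sub_zero, abs_of_nonneg ht.1]
    exact lt_of_le_of_lt ht.2 hεr
  obtain ⟨hi, ht⟩ := hf ε N hε0 hεN
  have ht2 := ht.const_mul C
  rw [mul_zero] at ht2
  filter_upwards [Ioo_mem_nhdsGT (show (0:ℝ) < 1 by norm_num), ht2.eventually (gt_mem_nhds (show 0 < e/2 by positivity))] with δ hδ hδ2
  have hc := hV δ hδ.1
  have hvi : ∀ a b, IntervalIntegrable (V δ) volume a b := fun a b => hc.intervalIntegrable a b
  have hD1 : IntervalIntegrable (fun t => V δ t - f t) volume 0 ε := (hvi _ _).sub (hfi2 _ hε0.le)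
  have hD2 : IntervalIntegrable (fun t => V δ t - f t) volume ε N :=
    (hvi _ _).sub ((intervalIntegrable_iff_integrableOn_Icc_of_le hεN).2 hi)
  rw [Real.dist_eq, ← intervalIntegral.integral_sub ((hvi _ _).mul_continuousOn hψ.continuousOn)
    ((hfi2 _ hN.le).mul_continuousOn hψ.continuousOn)]
  simp_rw [← sub_mul]
  rw [← intervalIntegral.integral_add_adjacent_intervals
    (hD1.mul_continuousOn hψ.continuousOn) (hD2.mul_continuousOn hψ.continuousOn)]
  have b1 : |∫ t in (0:ℝ)..ε, (V δ t - f t) * ψ t| ≤ (M + Mf) * e1 := by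
    calc |∫ t in (0:ℝ)..ε, (V δ t - f t) * ψ t| ≤ ∫ t in (0:ℝ)..ε, |(V δ t - f t) * ψ t| :=
          intervalIntegral.abs_integral_le_integral_abs hε0.le
      _ ≤ ∫ t in (0:ℝ)..ε, (|V δ t| + |f t|) * e1 := by
          apply intervalIntegral.integral_mono_on hε0.le (hD1.mul_continuousOn hψ.continuousOn).abs
          · exact ((hvi _ _).abs.add (hfi2 _ hε0.le).abs).mul_const _
          · intro t ht
            rw [abs_mul]
            exact mul_le_mul (abs_sub _ _) (hsm t ht) (abs_nonneg _) (by positivity)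
      _ = ((∫ t in (0:ℝ)..ε, |V δ t|) + ∫ t in (0:ℝ)..ε, |f t|) * e1 := by
          rw [intervalIntegral.integral_mul_const, intervalIntegral.integral_add (hvi _ _).abs (hfi2 _ hε0.le).abs]
      _ ≤ (M + Mf) * e1 := by
          gcongr
          · refine le_trans ?_ (hM δ hδ)
            apply intervalIntegral.integral_mono_interval le_rfl hε0.le hεl
            · filter_upwards with t using abs_nonneg _
            · exact (hvi _ _).abs
          · apply intervalIntegral.integral_mono_interval le_rfl hε0.le hεN
            · filter_upwards with t using abs_nonneg _
            · exact (hfi2 _ hN.le).abs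
  have b2 : |∫ t in ε..N, (V δ t - f t) * ψ t| ≤ C * ∫ t in ε..N, |V δ t - f t| := by
    calc |∫ t in ε..N, (V δ t - f t) * ψ t| ≤ ∫ t in ε..N, |(V δ t - f t) * ψ t| :=
          intervalIntegral.abs_integral_le_integral_abs hεN
      _ ≤ ∫ t in ε..N, C * |V δ t - f t| := by
          apply intervalIntegral.integral_mono_on hεN (hD2.mul_continuousOn hψ.continuousOn).abs
          · exact hD2.abs.const_mul _
          · intro t ht
            rw [abs_mul, mul_comm]
            exact mul_le_mul_of_nonneg_right (hC t ⟨hε0.le.trans ht.1, ht.2⟩) (abs_nonneg _)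
      _ = _ := by rw [intervalIntegral.integral_const_mul]
  have b3 : (M + Mf) * e1 < e / 2 := by
    rw [he1, ← mul_div_assoc, div_lt_iff₀ (by positivity)]
    nlinarith
  have := abs_add_le (∫ t in (0:ℝ)..ε, (V δ t - f t) * ψ t) (∫ t in ε..N, (V δ t - f t) * ψ t)
  linarith

/-- Riemann-Lebesgue for cosine -/
lemma rl_cos {F : ℝ → ℝ} {N : ℝ} (hN : 0 ≤ N) (hF : IntegrableOn F (Ioc 0 N)) :
    Tendsto (fun h => ∫ t in (0:ℝ)..N, F t * Real.cos (h * t)) atTop (nhds 0) := by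
  have h1 := Real.tendsto_integral_exp_smul_cocompact (fun t => ((indicator (Ioc 0 N) F t : ℝ) : ℂ))
  have h2 : Tendsto (fun h : ℝ => h * (2 * Real.pi)⁻¹) atTop (cocompact ℝ) :=
    (tendsto_id.atTop_mul_const (by positivity)).mono_right atTop_le_cocompact
  have h3 := (Complex.continuous_re.tendsto _).comp (h1.comp h2)
  rw [Complex.zero_re] at h3
  refine h3.congr ?_
  intro h
  simp only [Function.comp]
  have hint : Integrable (indicator (Ioc 0 N) F) := by
    rw [integrable_indicator_iff measurableSet_Ioc]; exact hF
  have e : (∫ v : ℝ, Real.fourierChar (-(v * (h * (2 * Real.pi)⁻¹))) • ((indicator (Ioc 0 N) F v : ℝ) : ℂ)).re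
      = ∫ v : ℝ, (Real.fourierChar (-(v * (h * (2 * Real.pi)⁻¹))) • ((indicator (Ioc 0 N) F v : ℝ) : ℂ)).re := by
    refine (integral_re (𝕜 := ℂ) ?_).symm
    have := (Real.fourierIntegral_convergent_iff (f := fun v => ((indicator (Ioc 0 N) F v : ℝ) : ℂ)) (μ := volume) (h * (2 * Real.pi)⁻¹)).2 hint.ofReal
    refine this.congr ?_
    filter_upwards with v
    simp [mul_comm]
  rw [e, intervalIntegral.integral_of_le hN, ← integral_indicator measurableSet_Ioc]
  congr 1; funext v
  by_cases hv : v ∈ Ioc 0 N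
  · simp only [indicator_of_mem hv, Circle.smul_def, Real.fourierChar_apply, smul_eq_mul, Complex.re_mul_ofReal]
    rw [Complex.exp_ofReal_mul_I_re, mul_comm]
    congr 1
    rw [← Real.cos_neg]
    congr 1
    field_simp
  · simp [indicator_of_notMem hv]

lemma kernel_lower {H : ℝ → ℝ} (hHm : AEStronglyMeasurable H) {B c R : ℝ} (hB : ∀ u, |H u| ≤ B)
    (hc : |c| ≤ B) (hR : ∀ u, |u| ≤ R → c ≤ H u) :
    c * (∫ u, wk u) - 2 * B * (∫ u in {u : ℝ | R < |u|}, wk u) ≤ ∫ u, H u * wk u := by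
  have hms : MeasurableSet {u : ℝ | R < |u|} := measurableSet_lt measurable_const measurable_id.abs
  rw [← integral_indicator hms, ← integral_const_mul, ← integral_const_mul, ← integral_sub (wk_int.const_mul _) ((wk_int.indicator hms).const_mul _)]
  apply integral_mono
  · exact (wk_int.const_mul _).sub ((wk_int.indicator hms).const_mul _)
  · exact wk_int.bdd_mul hHm (by filter_upwards with u; exact hB u)
  intro u
  have hk := wk_nonneg u
  by_cases hu : R < |u|
  · simp only [indicator_of_mem (show u ∈ {u : ℝ | R < |u|} from hu)]
    have := neg_le_of_abs_le (hB u)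
    have := le_of_abs_le hc
    nlinarith
  · simp only [indicator_of_notMem (show u ∉ {u : ℝ | R < |u|} from hu)]
    have := hR u (not_lt.1 hu)
    nlinarith

lemma wk_tail : Tendsto (fun R : ℝ => ∫ u in {u : ℝ | R < |u|}, wk u) atTop (nhds 0) := by
  have hms : ∀ R, MeasurableSet {u : ℝ | R < |u|} := fun R => measurableSet_lt measurable_const measurable_id.abs
  have : Tendsto (fun R : ℝ => ∫ u, indicator {u : ℝ | R < |u|} wk u) atTop (nhds (∫ u : ℝ, (0:ℝ))) := by
    refine tendsto_integral_filter_of_dominated_convergence wk ?_ ?_ wk_int ?_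
    · filter_upwards with R
      exact (wk_int.indicator (hms R)).aestronglyMeasurable
    · filter_upwards with R
      filter_upwards with u
      refine (norm_indicator_le_norm_self _ _).trans ?_
      rw [Real.norm_of_nonneg (wk_nonneg u)]
    · filter_upwards with u
      apply tendsto_const_nhds.congr'
      filter_upwards [eventually_ge_atTop |u|] with R hR
      rw [indicator_of_notMem]
      simpa using hR
  simp only [integral_zero] at this
  refine this.congr ?_
  intro R
  rw [integral_indicator (hms R)]

lemma taub {G : ℝ → ℝ} (hm : AEStronglyMeasurable G) {B a : ℝ} (hB : ∀ x, |G x| ≤ B)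
    (hslow : ∀ ε > 0, ∃ η > 0, ∃ X, ∀ x y, X ≤ x → x ≤ y → y ≤ x + η → G x - ε ≤ G y)
    (hF : ∀ L > 0, Tendsto (fun h => ∫ u, G (h + u / L) * wk u) atTop (nhds (a * ∫ u, wk u))) :
    Tendsto G atTop (nhds a) := by
  set I := ∫ u, wk u with hI
  have hIp : 0 < I := wk_I_pos
  have hB0 : 0 ≤ B := (abs_nonneg _).trans (hB 0)
  rw [Metric.tendsto_atTop']
  intro e he
  set ε := min (e / 4) 1 with hε
  have hε0 : 0 < ε := by positivity
  have hε4 : ε ≤ e / 4 := min_le_left _ _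
  obtain ⟨η, hη, X, hX⟩ := hslow ε hε0
  -- choose R
  obtain ⟨R, hR, hR0⟩ := ((wk_tail.eventually (gt_mem_nhds (show 0 < ε * I / (2 * (B + ε) + 1) by positivity))).and (eventually_gt_atTop 0)).exists
  rw [lt_div_iff₀ (by positivity)] at hR
  have htn : 0 ≤ ∫ u in {u : ℝ | R < |u|}, wk u := integral_nonneg wk_nonneg
  set T := ∫ u in {u : ℝ | R < |u|}, wk u
  set L := 2 * R / η with hL
  have hLp : 0 < L := by positivity
  have hmeas : ∀ z : ℝ, AEStronglyMeasurable (fun u => G (z + u / L)) := by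
    intro z
    have : Measure.QuasiMeasurePreserving (fun u : ℝ => z + u / L) := by
      have h1 : Measure.QuasiMeasurePreserving (fun u : ℝ => z + u) :=
        (measurePreserving_add_left volume z).quasiMeasurePreserving
      have h2 : Measure.QuasiMeasurePreserving (fun u : ℝ => L⁻¹ • u) :=
        Measure.quasiMeasurePreserving_smul volume (inv_ne_zero hLp.ne')
      have e : (fun u : ℝ => z + u / L) = (fun u : ℝ => z + u) ∘ (fun u : ℝ => L⁻¹ • u) := by
        funext u
        simp [div_eq_inv_mul]
      rw [e]
      exact h1.comp h2
    exact hm.comp_quasiMeasurePreserving this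
  have hwin : ∀ u, |u| ≤ R → |u / L| ≤ η / 2 := by
    intro u hu
    rw [abs_div, abs_of_pos hLp, div_le_iff₀ hLp, hL]
    have : η / 2 * (2 * R / η) = R := by field_simp
    linarith
  obtain ⟨Y, hY⟩ := (Metric.tendsto_atTop.1 (hF L hLp)) (ε * I) (by positivity)
  refine ⟨max (X + η) (Y + η), fun x hx => ?_⟩
  have hx1 : X + η < x := (le_max_left _ _).trans_lt hx
  have hx2 : Y + η < x := (le_max_right _ _).trans_lt hx
  have u1 := hY (x + η / 2) (by linarith)
  have u2 := hY (x - η / 2) (by linarith)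
  have hGx := abs_le.1 (hB x)
  have k1 := kernel_lower (hmeas (x + η/2)) (B := B + ε) (c := G x - ε) (R := R)
    (fun u => (hB _).trans (by linarith)) (abs_le.2 ⟨by linarith, by linarith⟩) (by
      intro u hu
      have := abs_le.1 (hwin u hu)
      exact hX _ _ (by linarith) (by linarith) (by linarith))
  have k2 := kernel_lower (hmeas (x - η/2)).neg (B := B + ε) (c := - G x - ε) (R := R)
    (fun u => by simp only [Pi.neg_apply, abs_neg]; exact (hB _).trans (by linarith)) (abs_le.2 ⟨by linarith, by linarith⟩) (by
      intro u hu
      have := abs_le.1 (hwin u hu)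
      have := hX (x - η/2 + u / L) x (by linarith) (by linarith) (by linarith)
      simp only [Pi.neg_apply]
      linarith)
  simp only [Pi.neg_apply, neg_mul, integral_neg] at k2
  rw [Real.dist_eq, abs_lt] at u1 u2 ⊢
  have hT : 2 * (B + ε) * T ≤ ε * I := by nlinarith
  change _ - 2 * (B + ε) * T ≤ _ at k1
  change _ - 2 * (B + ε) * T ≤ _ at k2
  have q1 : (G x - a - 3 * ε) * I < 0 := by nlinarith
  have q2 : (a - G x - 3 * ε) * I < 0 := by nlinarith
  have q1' := (neg_of_mul_neg_left q1 hIp.le)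
  have q2' := (neg_of_mul_neg_left q2 hIp.le)
  constructor <;> linarith

def gSlow (g : ℝ → ℝ) : Prop := ∀ ε > 0, ∃ η > 0, ∃ X > 0, ∀ x y, X ≤ x → x ≤ y → y ≤ x + η →
  Real.exp (-(y - x)) * (g x - ε) ≤ g y

lemma exp_nonpos_mul_ge {s c D : ℝ} (hs : 0 ≤ s) (hD : 0 ≤ D) (hc : -D ≤ c) : -D ≤ Real.exp (-s) * c := by
  have h1 : Real.exp (-s) ≤ 1 := Real.exp_le_one_iff.2 (by linarith)
  have h2 := Real.exp_pos (-s)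
  nlinarith

lemma gSlow_lower {g : ℝ → ℝ} (hs : gSlow g) : ∃ C ≥ 0, ∃ X > 0, ∀ x, X ≤ x → -C ≤ g x := by
  obtain ⟨η, hη, X, hX0, hX⟩ := hs 1 one_pos
  set q := Real.exp (-η) with hq
  have hq0 : 0 < q := Real.exp_pos _
  have hq1 : q < 1 := by rw [hq, Real.exp_lt_one_iff]; linarith
  have h1q : 0 < 1 - q := by linarith
  have hqq : q / (1 - q) * (1 - q) = q := by field_simp
  have hqp : 0 ≤ q / (1 - q) := by positivity
  set D := |g X| + 1 + q / (1 - q) with hD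
  have habs := abs_nonneg (g X)
  have hD0 : 0 ≤ D := by positivity
  have key : ∀ n : ℕ, ∀ x, X ≤ x → x ≤ X + (n + 1) * η → -D ≤ g x := by
    intro n
    induction n with
    | zero =>
      intro x h1 h2
      refine le_trans ?_ (hX X x le_rfl h1 (by simpa using h2))
      apply exp_nonpos_mul_ge (by linarith) hD0
      have := neg_abs_le (g X)
      linarith
    | succ n ih =>
      intro x h1 h2
      by_cases hx : x ≤ X + (n + 1) * η
      · exact ih x h1 hx
      · push Not at hx
        push_cast at h2
        have hnn : 0 ≤ (n:ℝ) * η := by positivity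
        have i1 := ih (x - η) (by linarith) (by linarith)
        have i2 := hX (x - η) x (by linarith) (by linarith) (by linarith)
        rw [show -(x - (x - η)) = -η by ring, ← hq] at i2
        have : D * (1 - q) ≥ q := by nlinarith
        nlinarith
  refine ⟨D, hD0, X, hX0, fun x hx => ?_⟩
  obtain ⟨n, hn⟩ := exists_nat_ge ((x - X) / η)
  apply key n x hx
  rw [div_le_iff₀ hη] at hn
  nlinarith

lemma g_loc {g : ℝ → ℝ} (hg : ∀ δ > 0, IntegrableOn (fun x => Real.exp (-δ * x) * g x) (Ioi 0)) (X : ℝ) :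
    IntegrableOn g (Ioc 0 X) := by
  have h1 : IntegrableOn (fun x => Real.exp (-1 * x) * g x) (Ioc 0 X) :=
    (hg 1 one_pos).mono_set Ioc_subset_Ioi_self
  have h2 := h1.continuousOn_mul_of_subset (g := fun x => Real.exp x) (K := Icc 0 X) (by fun_prop)
    isCompact_Icc measurableSet_Ioc Ioc_subset_Icc_self
  refine h2.congr ?_
  filter_upwards with x
  rw [← mul_assoc, ← Real.exp_add]; simp

lemma g_meas {g : ℝ → ℝ} (hg : ∀ δ > 0, IntegrableOn (fun x => Real.exp (-δ * x) * g x) (Ioi 0)) :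
    AEStronglyMeasurable g (volume.restrict (Ioi 0)) := by
  have h1 := (hg 1 one_pos).aestronglyMeasurable
  have h2 : AEStronglyMeasurable (fun x : ℝ => Real.exp x) (volume.restrict (Ioi 0)) := by fun_prop
  refine (h2.mul h1).congr ?_
  filter_upwards with x
  simp only [Pi.mul_apply]
  rw [← mul_assoc, ← Real.exp_add]; simp

lemma exp_le_one' {δ x : ℝ} (hδ : 0 < δ) (hx : 0 < x) : Real.exp (-δ * x) ≤ 1 := by
  rw [Real.exp_le_one_iff]; nlinarith

lemma g_upper_s1 {g : ℝ → ℝ} (hg : ∀ δ > 0, IntegrableOn (fun x => Real.exp (-δ * x) * g x) (Ioi 0))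
    (hs : gSlow g) {lam M : ℝ} (hlam : 0 < lam)
    (hM : ∀ δ ∈ Ioo (0:ℝ) 1, ∫ t in (0:ℝ)..lam, |wV g δ t| ≤ M) :
    ∃ B ≥ 0, ∃ X > 0, ∀ x, X < x → |g x| ≤ B := by
  obtain ⟨C, hC, X0, hX0, hlow⟩ := gSlow_lower hs
  obtain ⟨η, hη, X, hXp, hX⟩ := hs 1 one_pos
  obtain ⟨r, hr, hr2⟩ : ∃ r > 0, ∀ u, |u| ≤ r → 1 / 4 ≤ wk u := by
    have : ∀ᶠ u in nhds (0:ℝ), 1 / 4 < wk u :=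
      wk_cont.continuousAt.eventually (lt_mem_nhds (by rw [wk_zero]; norm_num))
    obtain ⟨r, hr, hr2⟩ := Metric.eventually_nhds_iff.1 this
    refine ⟨r / 2, by positivity, fun u hu => (hr2 ?_).le⟩
    rw [Real.dist_eq, sub_zero]; linarith
  set η' := min η (r / lam) with hη'
  have hηp : 0 < η' := by positivity
  set X1 := max X X0
  have hX1 : 0 < X1 := lt_max_of_lt_left hXp
  set I := ∫ u, wk u
  set C1 := lam / 2 * ∫ y in Ioc 0 X1, |g y|
  set C2 := M + C1 + C * I with hC2
  have main : ∀ x, X1 < x → ∀ δ ∈ Ioo (0:ℝ) 1, 1 ≤ g x →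
      η' * (Real.exp (-η') * (g x - 1) * Real.exp (-δ * (x + η')) * (lam / 8)) ≤ C2 := by
    intro x hx δ hδ hgx
    set E := fun y => (Real.exp (-δ * y) * g y) * wK lam x y with hE
    have hEi : IntegrableOn E (Ioi 0) :=
      (hg δ hδ.1).mul_bdd (c := lam / 2) (wK_cont _ _).aestronglyMeasurable (by
        filter_upwards with y
        rw [Real.norm_of_nonneg (wK_nonneg hlam _ _)]
        exact wK_le hlam _ _)
    have e1 : ∫ y in Ioi 0, E y ≤ M := by
      rw [← wV_fubini (hg δ hδ.1) hlam le_rfl x]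
      refine le_trans ?_ (hM δ hδ)
      have hc := wV_cont (hg δ hδ.1)
      have hc2 := wphi_cont lam
      apply intervalIntegral.integral_mono_on hlam.le
      · apply Continuous.intervalIntegrable; fun_prop
      · apply Continuous.intervalIntegrable; fun_prop
      · intro t ht
        refine (le_abs_self _).trans ?_
        rw [abs_mul, abs_mul, abs_of_nonneg (wphi_nonneg _ _)]
        apply mul_le_of_le_one_right (abs_nonneg _)
        exact mul_le_one₀ (wphi_le_one hlam ht.1) (abs_nonneg _) (Real.abs_cos_le_one _)
    have hsplit : Ioi (0:ℝ) = Ioc 0 X1 ∪ Ioi X1 := (Ioc_union_Ioi_eq_Ioi hX1.le).symm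
    have hE1 : IntegrableOn E (Ioc 0 X1) := hEi.mono_set Ioc_subset_Ioi_self
    have hE2 : IntegrableOn E (Ioi X1) := hEi.mono_set (Ioi_subset_Ioi hX1.le)
    rw [hsplit, setIntegral_union (Ioc_disjoint_Ioi le_rfl) measurableSet_Ioi hE1 hE2] at e1
    have e2 : -C1 ≤ ∫ y in Ioc 0 X1, E y := by
      simp only [C1]
      rw [← integral_const_mul, ← integral_neg]
      apply setIntegral_mono_on ((g_loc hg X1).abs.const_mul _).neg hE1 measurableSet_Ioc
      intro y hy
      refine le_trans (neg_le_neg ?_) (neg_abs_le _)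
      simp only [hE]
      rw [abs_mul, abs_mul, Real.abs_exp, abs_of_nonneg (wK_nonneg hlam _ _), mul_comm]
      apply mul_le_mul (wK_le hlam _ _) _ (by positivity) (by positivity)
      exact mul_le_of_le_one_left (abs_nonneg _) (exp_le_one' hδ.1 hy.1)
    set P := fun y => Real.exp (-δ * y) * (C * wK lam x y) with hP
    have hPi : IntegrableOn P (Ioi X1) := by
      apply Integrable.bdd_mul (c := 1)
      · exact ((wK_int hlam x).const_mul C).integrableOn
      · fun_prop
      · filter_upwards [ae_restrict_mem measurableSet_Ioi] with y hy
        rw [Real.norm_of_nonneg (Real.exp_pos _).le]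
        exact exp_le_one' hδ.1 (hX1.trans hy)
    have e3 : ∫ y in Ioi X1, P y ≤ C * I := by
      have : C * I = ∫ y, C * wK lam x y := by rw [integral_const_mul, wK_integral hlam]
      rw [this]
      have hi := ((wK_int hlam x).const_mul C)
      refine le_trans ?_ (setIntegral_le_integral (s := Ioi X1) hi ?_)
      · apply setIntegral_mono_on hPi hi.integrableOn measurableSet_Ioi
        intro y hy
        apply mul_le_of_le_one_left
        · have := wK_nonneg hlam x y
          positivity
        · exact exp_le_one' hδ.1 (hX1.trans hy)
      · filter_upwards with y
        have := wK_nonneg hlam x y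
        simp only [Pi.zero_apply]
        positivity
    have e4 : ∫ y in Ioi X1, (E y + P y) ≤ C2 := by
      rw [integral_add hE2 hPi]; linarith
    refine le_trans ?_ e4
    have hEP : ∀ y, E y + P y = Real.exp (-δ * y) * ((g y + C) * wK lam x y) := by
      intro y; simp only [hE, hP]; ring
    have hnn : ∀ y, X1 < y → 0 ≤ E y + P y := by
      intro y hy
      rw [hEP]
      have h1 := hlow y ((le_max_right _ _).trans hy.le)
      have h2 := wK_nonneg hlam x y
      have : 0 ≤ g y + C := by linarith
      positivity
    have hsub : Ioc x (x + η') ⊆ Ioi X1 := fun y hy => hx.trans hy.1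
    calc η' * (Real.exp (-η') * (g x - 1) * Real.exp (-δ * (x + η')) * (lam / 8))
        = ∫ y in Ioc x (x + η'), (Real.exp (-η') * (g x - 1) * Real.exp (-δ * (x + η')) * (lam / 8)) := by
          rw [setIntegral_const]; simp [hηp.le]
      _ ≤ ∫ y in Ioc x (x + η'), (E y + P y) := by
          apply setIntegral_mono_on _ ((hE2.add hPi).mono_set hsub) measurableSet_Ioc
          · intro y hy
            change _ ≤ E y + P y
            rw [hEP]
            have s1 := hX x y ((le_max_left _ _).trans hx.le) hy.1.le (hy.2.trans (by have := min_le_left η (r/lam); linarith))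
            have s2 : Real.exp (-η') * (g x - 1) ≤ g y + C := by
              have : Real.exp (-η') ≤ Real.exp (-(y - x)) := Real.exp_le_exp.2 (by linarith [hy.2])
              nlinarith
            have s3 : Real.exp (-δ * (x + η')) ≤ Real.exp (-δ * y) := Real.exp_le_exp.2 (by nlinarith [hy.2, hδ.1])
            have s4 : lam / 8 ≤ wK lam x y := by
              unfold wK
              have t1 := wk_nonneg (lam * (y + x))
              have t2 := hr2 (lam * (y - x)) (by
                rw [abs_of_nonneg (mul_nonneg hlam.le (by linarith [hy.1]))]
                have : y - x ≤ r / lam := by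
                  have := min_le_right η (r/lam)
                  linarith [hy.2]
                rw [le_div_iff₀ hlam] at this
                linarith)
              nlinarith
            have s0 : 0 ≤ Real.exp (-η') * (g x - 1) := mul_nonneg (Real.exp_pos _).le (by linarith)
            calc _ = Real.exp (-δ * (x + η')) * ((Real.exp (-η') * (g x - 1)) * (lam / 8)) := by ring
              _ ≤ _ := by
                apply mul_le_mul s3 _ (by positivity) (Real.exp_pos _).le
                exact mul_le_mul s2 s4 (by positivity) (s0.trans s2)
          · exact integrableOn_const (by simp)
      _ ≤ ∫ y in Ioi X1, (E y + P y) := by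
          apply setIntegral_mono_set (hE2.add hPi)
          · filter_upwards [ae_restrict_mem measurableSet_Ioi] with y hy using hnn y hy
          · exact hsub.eventuallyLE
  set B := 1 + |C2| / (η' * (Real.exp (-η') * (lam / 8))) with hB
  have hdp : 0 < η' * (Real.exp (-η') * (lam / 8)) := by positivity
  have hB1 : 1 ≤ B := by
    have : 0 ≤ |C2| / (η' * (Real.exp (-η') * (lam / 8))) := by positivity
    linarith
  refine ⟨B + C, by linarith, X1, hX1, fun x hx => ?_⟩
  have h1 := hlow x ((le_max_right _ _).trans hx.le)
  rw [abs_le]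
  refine ⟨by linarith, ?_⟩
  by_cases hgx : 1 ≤ g x
  · have : η' * (Real.exp (-η') * (g x - 1) * Real.exp (-0 * (x + η')) * (lam / 8)) ≤ C2 := by
      have hcont : Continuous (fun δ : ℝ => η' * (Real.exp (-η') * (g x - 1) * Real.exp (-δ * (x + η')) * (lam / 8))) := by fun_prop
      have := (hcont.tendsto 0).mono_left (nhdsWithin_le_nhds (s := Ioi 0))
      refine le_of_tendsto this ?_
      filter_upwards [Ioo_mem_nhdsGT (show (0:ℝ) < 1 by norm_num)] with δ hδ
      exact main x hx δ hδ hgx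
    simp only [neg_zero, zero_mul, Real.exp_zero, mul_one] at this
    have h3 : g x - 1 ≤ |C2| / (η' * (Real.exp (-η') * (lam / 8))) := by
      rw [le_div_iff₀ hdp]
      have := le_abs_self C2
      linarith
    linarith
  · linarith

lemma wk_atTop : Tendsto wk (cocompact ℝ) (nhds 0) := by
  have h : Tendsto (fun x : ℝ => 4 * (1 + x ^ 2)⁻¹) (cocompact ℝ) (nhds 0) := by
    have h1 : Tendsto (fun x : ℝ => 1 + x ^ 2) (cocompact ℝ) atTop := by
      apply tendsto_atTop_add_const_left
      have := (tendsto_pow_atTop (α := ℝ) (n := 2) (by norm_num)).comp (tendsto_norm_cocompact_atTop (E := ℝ))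
      refine this.congr ?_
      intro x; simp
    simpa using (tendsto_inv_atTop_zero.comp h1).const_mul 4
  exact squeeze_zero wk_nonneg wk_le h

lemma wk_lim_sub {L : ℝ} (hL : 0 < L) (x : ℝ) : Tendsto (fun h => L * wk (L * (x - h))) atTop (nhds 0) := by
  have h1 : Tendsto (fun h : ℝ => L * (x - h)) atTop (cocompact ℝ) := by
    refine Tendsto.mono_right ?_ atBot_le_cocompact
    have h0 : Tendsto (fun h : ℝ => x - h) atTop atBot := by
      simpa [sub_eq_add_neg] using tendsto_atBot_add_const_left atTop x (tendsto_neg_atTop_atBot (G := ℝ))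
    exact h0.const_mul_atBot hL
  simpa using (wk_atTop.comp h1).const_mul L

lemma wk_lim_add {L : ℝ} (hL : 0 < L) (x : ℝ) : Tendsto (fun h => L * wk (L * (x + h))) atTop (nhds 0) := by
  have h1 : Tendsto (fun h : ℝ => L * (x + h)) atTop (cocompact ℝ) := by
    refine Tendsto.mono_right ?_ atTop_le_cocompact
    apply Tendsto.const_mul_atTop hL
    exact tendsto_atTop_add_const_left _ _ tendsto_id
  simpa using (wk_atTop.comp h1).const_mul L

lemma gwK_int {g : ℝ → ℝ} (hg : ∀ δ > 0, IntegrableOn (fun x => Real.exp (-δ * x) * g x) (Ioi 0))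
    {B X : ℝ} (hX : 0 < X) (hB : ∀ x, X < x → |g x| ≤ B) {L : ℝ} (hL : 0 < L) (h : ℝ) :
    IntegrableOn (fun x => g x * wK L h x) (Ioi 0) := by
  rw [← Ioc_union_Ioi_eq_Ioi hX.le]
  apply IntegrableOn.union
  · exact (g_loc hg X).mul_bdd (c := L / 2) (wK_cont _ _).aestronglyMeasurable (by
        filter_upwards with y
        rw [Real.norm_of_nonneg (wK_nonneg hL _ _)]
        exact wK_le hL _ _)
  · apply Integrable.bdd_mul (c := B) (wK_int hL h).integrableOn
    · exact (g_meas hg).mono_set (Ioi_subset_Ioi hX.le)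
    · filter_upwards [ae_restrict_mem measurableSet_Ioi] with y hy
      exact hB y hy

lemma gwK_lim {g : ℝ → ℝ} (hg : ∀ δ > 0, IntegrableOn (fun x => Real.exp (-δ * x) * g x) (Ioi 0))
    {B X : ℝ} (hX : 0 < X) (hB : ∀ x, X < x → |g x| ≤ B) {L : ℝ} (hL : 0 < L) (h : ℝ) :
    Tendsto (fun δ => ∫ x in Ioi (0:ℝ), (Real.exp (-δ * x) * g x) * wK L h x) (nhdsWithin 0 (Ioi 0))
      (nhds (∫ x in Ioi (0:ℝ), g x * wK L h x)) := by
  have hi := gwK_int hg hX hB hL h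
  refine tendsto_integral_filter_of_dominated_convergence (fun x => ‖g x * wK L h x‖) ?_ ?_ hi.norm ?_
  · filter_upwards [self_mem_nhdsWithin] with δ hδ
    exact (hg δ hδ).aestronglyMeasurable.mul (wK_cont _ _).aestronglyMeasurable
  · filter_upwards [self_mem_nhdsWithin] with δ hδ
    filter_upwards [ae_restrict_mem measurableSet_Ioi] with x hx
    rw [mul_assoc, norm_mul, Real.norm_of_nonneg (Real.exp_pos _).le]
    exact mul_le_of_le_one_left (norm_nonneg _) (exp_le_one' hδ hx)
  · filter_upwards with x
    have hc : Continuous (fun δ : ℝ => (Real.exp (-δ * x) * g x) * wK L h x) := by fun_prop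
    have := (hc.tendsto 0).mono_left (nhdsWithin_le_nhds (s := Ioi 0))
    simpa using this

lemma core_lim {g : ℝ → ℝ} (hg : ∀ δ > 0, IntegrableOn (fun x => Real.exp (-δ * x) * g x) (Ioi 0))
    {B X : ℝ} (hX : 0 < X) (hB : ∀ x, X < x → |g x| ≤ B) {f : ℝ → ℝ}
    (hf : ∀ ε N, 0 < ε → ε ≤ N → IntegrableOn f (Icc ε N) ∧
      Tendsto (fun δ => ∫ t in ε..N, |wV g δ t - f t|) (nhdsWithin 0 (Ioi 0)) (nhds 0))
    {lam M : ℝ} (hlam : 0 < lam) (hM : ∀ δ ∈ Ioo (0:ℝ) 1, ∫ t in (0:ℝ)..lam, |wV g δ t| ≤ M) :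
    ∃ A, ∀ L > 0, Tendsto (fun h => ∫ x in Ioi (0:ℝ), g x * wK L h x) atTop (nhds A) := by
  have hV : ∀ δ, 0 < δ → Continuous (wV g δ) := fun δ hδ => wV_cont (hg δ hδ)
  have hfi := key_int hV hf hlam hM
  refine ⟨(∫ x in Ioi (0:ℝ), g x * wK 1 0 x) - ∫ t in (0:ℝ)..1, f t * wphi 1 t, fun L hL => ?_⟩
  set N := max L 1
  have hLN : L ≤ N := le_max_left _ _
  have h1N : 1 ≤ N := le_max_right _ _
  have hN : 0 < N := hL.trans_le hLN
  have hfN : IntervalIntegrable f volume 0 N :=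
    (intervalIntegrable_iff_integrableOn_Ioc_of_le hN.le).2 (hfi N)
  have hcp := wphi_cont L
  have hcp1 := wphi_cont 1
  have e0 : ∫ t in (0:ℝ)..N, f t * wphi 1 t = ∫ t in (0:ℝ)..1, f t * wphi 1 t := by
    have hi : IntervalIntegrable (fun t => f t * wphi 1 t) volume 0 N := hfN.mul_continuousOn hcp1.continuousOn
    rw [← intervalIntegral.integral_add_adjacent_intervals (b := 1)
      (hi.mono_set (by rw [uIcc_of_le zero_le_one, uIcc_of_le hN.le]; exact Icc_subset_Icc_right h1N))
      (hi.mono_set (by rw [uIcc_of_le h1N, uIcc_of_le hN.le]; exact Icc_subset_Icc_left zero_le_one))]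
    have : ∫ t in (1:ℝ)..N, f t * wphi 1 t = 0 := by
      rw [intervalIntegral.integral_congr (g := fun _ => 0)]
      · simp
      · intro t ht
        rw [uIcc_of_le h1N] at ht
        simp only [wphi]
        rw [max_eq_right (by simp; exact ht.1)]; simp
    rw [this, add_zero]
  have hform : ∀ h, ∫ x in Ioi (0:ℝ), g x * wK L h x =
      (∫ x in Ioi (0:ℝ), g x * wK 1 0 x) - (∫ t in (0:ℝ)..1, f t * wphi 1 t)
        + ∫ t in (0:ℝ)..N, (f t * wphi L t) * Real.cos (h * t) := by
    intro h
    set ψ := fun t => wphi L t * Real.cos (h * t) - wphi 1 t * Real.cos (0 * t) with hψ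
    have t1 := key_tendsto hV hf hlam hM hN (ψ := ψ) (by fun_prop) (by simp [hψ, wphi_zero])
    have t2 := (gwK_lim hg hX hB hL h).sub (gwK_lim hg hX hB one_pos 0)
    have t3 : Tendsto (fun δ => ∫ t in (0:ℝ)..N, wV g δ t * ψ t) (nhdsWithin 0 (Ioi 0))
      (nhds ((∫ x in Ioi (0:ℝ), g x * wK L h x) - ∫ x in Ioi (0:ℝ), g x * wK 1 0 x)) := by
      refine t2.congr' ?_
      filter_upwards [self_mem_nhdsWithin] with δ hδ
      have := hV δ hδ
      rw [← wV_fubini (hg δ hδ) hL hLN h, ← wV_fubini (hg δ hδ) one_pos h1N 0, ← intervalIntegral.integral_sub]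
      · simp only [hψ, mul_sub]
      all_goals
        apply Continuous.intervalIntegrable
        fun_prop
    have u := tendsto_nhds_unique t1 t3
    have e1 : ∫ t in (0:ℝ)..N, f t * ψ t = (∫ t in (0:ℝ)..N, (f t * wphi L t) * Real.cos (h * t)) - ∫ t in (0:ℝ)..N, f t * wphi 1 t := by
      rw [← intervalIntegral.integral_sub]
      · congr 1; funext t; simp [hψ]; ring
      · simp only [mul_assoc]
        exact hfN.mul_continuousOn (by fun_prop)
      · exact hfN.mul_continuousOn (by fun_prop)
    rw [e0] at e1
    linarith
  simp only [hform]
  have hr := rl_cos hN.le (F := fun t => f t * wphi L t)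
    ((intervalIntegrable_iff_integrableOn_Ioc_of_le hN.le).1 (hfN.mul_continuousOn hcp.continuousOn))
  simpa using hr.const_add ((∫ x in Ioi (0:ℝ), g x * wK 1 0 x) - (∫ t in (0:ℝ)..1, f t * wphi 1 t))

lemma err1 {g : ℝ → ℝ} (hg : ∀ δ > 0, IntegrableOn (fun x => Real.exp (-δ * x) * g x) (Ioi 0))
    (X : ℝ) {L : ℝ} (hL : 0 < L) :
    Tendsto (fun h => ∫ x in Ioc 0 X, g x * wK L h x) atTop (nhds 0) := by
  have hi := g_loc hg X
  have : Tendsto (fun h => ∫ x in Ioc 0 X, g x * wK L h x) atTop (nhds (∫ x in Ioc 0 X, (0:ℝ))) := by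
    refine tendsto_integral_filter_of_dominated_convergence (fun x => ‖g x‖ * (L / 2)) ?_ ?_ (hi.norm.mul_const _) ?_
    · filter_upwards with h
      exact hi.aestronglyMeasurable.mul (wK_cont _ _).aestronglyMeasurable
    · filter_upwards with h
      filter_upwards with x
      rw [norm_mul, Real.norm_of_nonneg (wK_nonneg hL _ _)]
      exact mul_le_mul_of_nonneg_left (wK_le hL _ _) (norm_nonneg _)
    · filter_upwards with x
      have h1 := (((wk_lim_sub hL x).add (wk_lim_add hL x)).div_const 2).const_mul (g x)
      simpa [wK] using h1
  simpa using this

lemma err2 {g : ℝ → ℝ} (hg : ∀ δ > 0, IntegrableOn (fun x => Real.exp (-δ * x) * g x) (Ioi 0))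
    {B X : ℝ} (hX : 0 < X) (hB : ∀ x, X < x → |g x| ≤ B) {L : ℝ} (hL : 0 < L) :
    Tendsto (fun h => ∫ x in Ioi X, g x * (L * wk (L * (x + h)))) atTop (nhds 0) := by
  have : Tendsto (fun h => ∫ x in Ioi X, g x * (L * wk (L * (x + h)))) atTop (nhds (∫ x in Ioi X, (0:ℝ))) := by
    refine tendsto_integral_filter_of_dominated_convergence (fun x => B * (L * (4 * (1 + (L * x) ^ 2)⁻¹))) ?_ ?_ ?_ ?_
    · filter_upwards with h
      refine ((g_meas hg).mono_set (Ioi_subset_Ioi hX.le)).mul ?_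
      have : Continuous (fun x => L * wk (L * (x + h))) := by
        have := wk_cont
        fun_prop
      exact this.aestronglyMeasurable
    · filter_upwards [eventually_ge_atTop 0] with h hh
      filter_upwards [ae_restrict_mem measurableSet_Ioi] with x hx
      have hx' : 0 < x := hX.trans hx
      rw [norm_mul, Real.norm_of_nonneg (mul_nonneg hL.le (wk_nonneg _))]
      apply mul_le_mul (hB x hx) _ (mul_nonneg hL.le (wk_nonneg _)) ((abs_nonneg _).trans (hB x hx))
      apply mul_le_mul_of_nonneg_left _ hL.le
      refine (wk_le _).trans ?_
      gcongr
      linarith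
    · apply Integrable.const_mul
      apply Integrable.const_mul
      apply Integrable.const_mul
      exact (integrable_inv_one_add_sq.comp_mul_left' hL.ne').integrableOn
    · filter_upwards with x
      simpa using (wk_lim_add hL x).const_mul (g x)
  simpa using this

theorem core_s1 {g : ℝ → ℝ} (hg : ∀ δ > 0, IntegrableOn (fun x => Real.exp (-δ * x) * g x) (Ioi 0))
    (hs : gSlow g) {f : ℝ → ℝ}
    (hf : ∀ ε N, 0 < ε → ε ≤ N → IntegrableOn f (Icc ε N) ∧
      Tendsto (fun δ => ∫ t in ε..N, |wV g δ t - f t|) (nhdsWithin 0 (Ioi 0)) (nhds 0))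
    {lam M : ℝ} (hlam : 0 < lam) (hM : ∀ δ ∈ Ioo (0:ℝ) 1, ∫ t in (0:ℝ)..lam, |wV g δ t| ≤ M) :
    ∃ a, Tendsto g atTop (nhds a) := by
  obtain ⟨B, hB0, X, hX, hB⟩ := g_upper_s1 hg hs hlam hM
  obtain ⟨A, hA⟩ := core_lim hg hX hB hf hlam hM
  have hIp := wk_I_pos
  set I := ∫ u, wk u with hI
  refine ⟨2 * A / I, ?_⟩
  set G := indicator (Ioi X) g with hG
  have hGm : AEStronglyMeasurable G :=
    (aestronglyMeasurable_indicator_iff measurableSet_Ioi).2 ((g_meas hg).mono_set (Ioi_subset_Ioi hX.le))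
  have hGB : ∀ x, |G x| ≤ B := by
    intro x
    by_cases hx : x ∈ Ioi X
    · simp only [hG, indicator_of_mem hx]; exact hB x hx
    · simp only [hG, indicator_of_notMem hx]; simpa using hB0
  have hGlim : Tendsto G atTop (nhds (2 * A / I)) := by
    apply taub hGm hGB
    · intro ε hε
      obtain ⟨η, hη, Y, hY0, hY⟩ := hs (ε / 2) (by positivity)
      refine ⟨min η (ε / (2 * (B + 1))), by positivity, max Y (X + 1), fun x y h1 h2 h3 => ?_⟩
      have hx : x ∈ Ioi X := by
        have := (le_max_right Y (X+1)).trans h1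
        simp only [mem_Ioi]; linarith
      have hy : y ∈ Ioi X := lt_of_lt_of_le hx h2
      simp only [hG, indicator_of_mem hx, indicator_of_mem hy]
      have k1 := hY x y ((le_max_left _ _).trans h1) h2 (h3.trans (by gcongr; exact min_le_left _ _))
      have k2 : y - x ≤ ε / (2 * (B + 1)) := by
        have := min_le_right η (ε / (2 * (B + 1))); linarith
      rw [le_div_iff₀ (by positivity)] at k2
      have k3 := abs_le.1 (hB x hx)
      have k4 : 1 - (y - x) ≤ Real.exp (-(y - x)) := by
        have := Real.add_one_le_exp (-(y - x)); linarith
      have k5 : Real.exp (-(y - x)) ≤ 1 := Real.exp_le_one_iff.2 (by linarith)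
      have k6 : (1 - Real.exp (-(y - x))) * g x ≤ (y - x) * B := by
        have : (1 - Real.exp (-(y - x))) * g x ≤ (1 - Real.exp (-(y - x))) * B :=
          mul_le_mul_of_nonneg_left k3.2 (by linarith)
        nlinarith
      nlinarith
    · intro L hL
      have e : 2 * A / I * I = 2 * A := by field_simp
      rw [← hI, e]
      have h1 := ((hA L hL).sub (err1 hg X hL)).const_mul 2
      have h2 := h1.sub (err2 hg hX hB hL)
      rw [sub_zero, sub_zero] at h2
      refine h2.congr ?_
      intro h
      have hi := gwK_int hg hX hB hL h
      have hgb : ∀ h, IntegrableOn (fun x => g x * (L * wk (L * (x - h)))) (Ioi X) := by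
        intro h
        apply Integrable.bdd_mul (c := B) (wk_shift_int hL h).integrableOn
        · exact (g_meas hg).mono_set (Ioi_subset_Ioi hX.le)
        · filter_upwards [ae_restrict_mem measurableSet_Ioi] with y hy
          exact hB y hy
      rw [← Ioc_union_Ioi_eq_Ioi hX.le, setIntegral_union (Ioc_disjoint_Ioi le_rfl) measurableSet_Ioi
        (hi.mono_set Ioc_subset_Ioi_self) (hi.mono_set (Ioi_subset_Ioi hX.le))]
      have e1 : 2 * ∫ x in Ioi X, g x * wK L h x =
          (∫ x in Ioi X, g x * (L * wk (L * (x - h)))) + ∫ x in Ioi X, g x * (L * wk (L * (x + h))) := by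
        have h' := hgb (-h)
        simp only [sub_neg_eq_add] at h'
        rw [← integral_add (hgb h) h', ← integral_const_mul]
        congr 1; funext x; simp only [wK]; ring
      have e2 : ∫ x in Ioi X, g x * (L * wk (L * (x - h))) = ∫ u, G (h + u / L) * wk u := by
        rw [← integral_indicator measurableSet_Ioi]
        set F := indicator (Ioi X) (fun x => g x * (L * wk (L * (x - h)))) with hF
        have c1 : ∀ u, G (h + u / L) * wk u = L⁻¹ * F (h + u / L) := by
          intro u
          have hu : L * (h + u / L - h) = u := by field_simp; ring
          by_cases hx : h + u / L ∈ Ioi X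
          · simp only [hG, hF, indicator_of_mem hx, hu]
            field_simp
          · simp only [hG, hF, indicator_of_notMem hx]
            simp
        simp only [c1]
        rw [integral_const_mul, Measure.integral_comp_div (fun v => F (h + v)) L,
          integral_add_left_eq_self F h, abs_of_pos hL, smul_eq_mul]
        field_simp
      linarith
  refine hGlim.congr' ?_
  filter_upwards [eventually_gt_atTop X] with x hx
  simp only [hG]
  rw [indicator_of_mem (show x ∈ Ioi X from hx)]

/-- Abelian part -/
lemma abel_part {g : ℝ → ℝ} (hg : ∀ δ > 0, IntegrableOn (fun x => Real.exp (-δ * x) * g x) (Ioi 0))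
    {a : ℝ} (ha : Tendsto g atTop (nhds a)) :
    Tendsto (fun δ => δ * ∫ x in Ioi (0:ℝ), Real.exp (-δ * x) * g x) (nhdsWithin 0 (Ioi 0)) (nhds a) := by
  rw [Metric.tendsto_nhds]
  intro e he
  obtain ⟨X0, hX0⟩ := Metric.tendsto_atTop.1 ha (e / 2) (by positivity)
  set X := max X0 1
  have hX : 0 < X := lt_max_of_lt_right one_pos
  have hgl := g_loc hg X
  have hgla : IntegrableOn (fun x => g x - a) (Ioc 0 X) := hgl.sub (integrableOn_const (by simp))
  set Q := ∫ x in Ioc 0 X, |g x - a|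
  have hQ : Tendsto (fun δ : ℝ => δ * Q) (nhdsWithin 0 (Ioi 0)) (nhds 0) := by
    have : Continuous (fun δ : ℝ => δ * Q) := by fun_prop
    simpa using (this.tendsto 0).mono_left (nhdsWithin_le_nhds (s := Ioi 0))
  filter_upwards [self_mem_nhdsWithin, hQ.eventually (gt_mem_nhds (show 0 < e/2 by positivity))] with δ hδ hδ2
  have hδ0 : 0 < δ := hδ
  have hexp : IntegrableOn (fun x => Real.exp (-δ * x)) (Ioi 0) := exp_neg_integrableOn_Ioi 0 hδ0
  have hexpI : ∫ x in Ioi (0:ℝ), Real.exp (-δ * x) = 1 / δ := by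
    rw [integral_exp_mul_Ioi (by linarith)]; simp
  have hD : IntegrableOn (fun x => Real.exp (-δ * x) * (g x - a)) (Ioi 0) := by
    have := (hg δ hδ0).sub (hexp.mul_const a)
    refine this.congr ?_
    filter_upwards with x
    simp only [Pi.sub_apply]; ring
  have e1 : δ * (∫ x in Ioi (0:ℝ), Real.exp (-δ * x) * g x) - a = δ * ∫ x in Ioi (0:ℝ), Real.exp (-δ * x) * (g x - a) := by
    simp only [mul_sub]
    rw [integral_sub (hg δ hδ0) (hexp.mul_const a), integral_mul_const, hexpI]
    field_simp
  rw [Real.dist_eq, e1, abs_mul, abs_of_pos hδ0]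
  have e2 : |∫ x in Ioi (0:ℝ), Real.exp (-δ * x) * (g x - a)| ≤ Q + (e / 2) * (1 / δ) := by
    refine (abs_integral_le_integral_abs).trans ?_
    have hDa := hD.abs
    rw [← Ioc_union_Ioi_eq_Ioi hX.le, setIntegral_union (Ioc_disjoint_Ioi le_rfl) measurableSet_Ioi
        (IntegrableOn.mono_set hDa Ioc_subset_Ioi_self) (IntegrableOn.mono_set hDa (Ioi_subset_Ioi hX.le))]
    apply add_le_add
    · apply setIntegral_mono_on (IntegrableOn.mono_set hDa Ioc_subset_Ioi_self) hgla.abs measurableSet_Ioc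
      intro x hx
      rw [abs_mul, Real.abs_exp]
      exact mul_le_of_le_one_left (abs_nonneg _) (exp_le_one' hδ0 hx.1)
    · rw [← hexpI, ← integral_const_mul]
      refine le_trans ?_ (setIntegral_mono_set (s := Ioi X) (hexp.const_mul (e/2)) ?_ (Ioi_subset_Ioi hX.le).eventuallyLE)
      · apply setIntegral_mono_on (IntegrableOn.mono_set hDa (Ioi_subset_Ioi hX.le))
          (IntegrableOn.mono_set (hexp.const_mul (e/2)) (Ioi_subset_Ioi hX.le)) measurableSet_Ioi
        intro x hx
        rw [abs_mul, Real.abs_exp, mul_comm]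
        apply mul_le_mul_of_nonneg_right _ (Real.exp_pos _).le
        have := hX0 x ((le_max_left _ _).trans (le_of_lt hx))
        rw [Real.dist_eq] at this
        exact this.le
      · filter_upwards with x
        simp only [Pi.zero_apply]; positivity
  calc δ * |∫ x in Ioi (0:ℝ), Real.exp (-δ * x) * (g x - a)| ≤ δ * (Q + (e / 2) * (1 / δ)) :=
        mul_le_mul_of_nonneg_left e2 hδ0.le
    _ = δ * Q + e / 2 := by field_simp
    _ < e := by linarith
/-- Theorem 1.2 (B.2): Wiener–Ikehara theorem with uniformly bounded local
`L¹` means of the real part of the Laplace transform near `s = 1`. -/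
theorem wiener_ikehara_B2 (S : ℝ → ℝ)
    (hS : LocallyIntegrableOn S (Ici 0))
    (hslow : LogLinSlowlyDecreasing S)
    (hconv : ∀ s : ℂ, 1 < s.re →
      IntegrableOn (fun x : ℝ => Complex.exp (-s * x) * (S x : ℂ)) (Ioi 0))
    (U : ℂ → ℝ) (hU : ∀ s : ℂ, U s = (laplaceT S s).re)
    (hbd : L1locBoundaryBehavior U)
    (lam : ℝ) (hlam : 0 < lam)
    (hsup : ∃ M : ℝ, ∀ σ ∈ Ioo (1 : ℝ) 2,
      (∫⁻ t in Ioo (-lam) lam, ENNReal.ofReal |U (σ + t * Complex.I)|) ≤ ENNReal.ofReal M) :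
    ∃ a : ℝ,
      Tendsto (fun σ : ℝ => (σ - 1) * U σ) (nhdsWithin 1 (Ioi 1)) (nhds a) ∧
      Tendsto (fun x : ℝ => Real.exp (-x) * S x) atTop (nhds a) := by

  set g : ℝ → ℝ := fun x => Real.exp (-x) * S x with hgdef
  have hpt : ∀ (δ t x : ℝ), (Complex.exp (-(((1 + δ : ℝ) : ℂ) + t * Complex.I) * x) * (S x : ℂ)).re
      = (Real.exp (-δ * x) * g x) * Real.cos (t * x) := by
    intro δ t x
    rw [Complex.re_mul_ofReal, Complex.exp_re]
    simp only [hgdef]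
    have r1 : (-(((1 + δ : ℝ) : ℂ) + t * Complex.I) * x).re = -δ * x + -x := by
      simp; ring
    have r2 : (-(((1 + δ : ℝ) : ℂ) + t * Complex.I) * x).im = -(t * x) := by
      simp
    rw [r1, r2, Real.exp_add, Real.cos_neg]
    ring
  have hre : ∀ (δ t : ℝ), (((1 + δ : ℝ) : ℂ) + t * Complex.I).re = 1 + δ := by
    intro δ t; simp
  have hg : ∀ δ > 0, IntegrableOn (fun x => Real.exp (-δ * x) * g x) (Ioi 0) := by
    intro δ hδ
    have h1 := (hconv (((1 + δ : ℝ) : ℂ) + (0:ℝ) * Complex.I) (by rw [hre]; linarith)).re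
    refine h1.congr ?_
    filter_upwards with x
    change (Complex.exp (-(((1 + δ : ℝ) : ℂ) + (0:ℝ) * Complex.I) * x) * (S x : ℂ)).re = _
    rw [hpt]; simp
  have hUV : ∀ δ > 0, ∀ t : ℝ, U (((1 + δ : ℝ) : ℂ) + t * Complex.I) = wV g δ t := by
    intro δ hδ t
    have hi := hconv (((1 + δ : ℝ) : ℂ) + t * Complex.I) (by rw [hre]; linarith)
    rw [hU, laplaceT, wV]
    refine (integral_re (𝕜 := ℂ) hi).symm.trans ?_
    congr 1; funext x
    exact hpt δ t x
  have hs : gSlow g := by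
    intro ε hε
    obtain ⟨h, hh, x₀, hx₀, H⟩ := hslow ε hε
    refine ⟨h, hh, x₀, hx₀, fun x y h1 h2 h3 => ?_⟩
    have := H x y h1 h2 h3
    rw [ge_iff_le, le_div_iff₀ (Real.exp_pos x)] at this
    simp only [hgdef]
    have e1 : Real.exp (-(y - x)) = Real.exp (-y) * Real.exp x := by
      rw [← Real.exp_add]; congr 1; ring
    have e2 : Real.exp x * Real.exp (-x) = 1 := by rw [← Real.exp_add]; simp
    calc Real.exp (-(y - x)) * (Real.exp (-x) * S x - ε)
        = Real.exp (-y) * ((Real.exp x * Real.exp (-x)) * S x - ε * Real.exp x) := by rw [e1]; ring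
      _ ≤ Real.exp (-y) * S y := by
        rw [e2]
        apply mul_le_mul_of_nonneg_left _ (Real.exp_pos _).le
        linarith
  have hshift : Tendsto (fun δ : ℝ => 1 + δ) (nhdsWithin 0 (Ioi 0)) (nhdsWithin 1 (Ioi 1)) := by
    apply tendsto_nhdsWithin_of_tendsto_nhds_of_eventually_within
    · have : Continuous (fun δ : ℝ => 1 + δ) := by fun_prop
      simpa using (this.tendsto 0).mono_left (nhdsWithin_le_nhds (s := Ioi 0))
    · filter_upwards [self_mem_nhdsWithin] with δ hδ
      have : 0 < δ := hδ
      simpa using this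
  obtain ⟨f, hf⟩ := hbd
  have hf' : ∀ ε N, 0 < ε → ε ≤ N → IntegrableOn f (Icc ε N) ∧
      Tendsto (fun δ => ∫ t in ε..N, |wV g δ t - f t|) (nhdsWithin 0 (Ioi 0)) (nhds 0) := by
    intro ε N hε hN
    obtain ⟨h1, h2⟩ := hf ε N hN (fun h => absurd h.1 (not_le.2 hε))
    refine ⟨h1, (h2.comp hshift).congr' ?_⟩
    filter_upwards [self_mem_nhdsWithin] with δ hδ
    simp only [Function.comp]
    congr 1; funext t
    rw [hUV δ hδ]
  obtain ⟨M, hM⟩ := hsup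
  have hM' : ∀ δ ∈ Ioo (0:ℝ) 1, ∫ t in (0:ℝ)..lam, |wV g δ t| ≤ max M 0 := by
    intro δ hδ
    have h1 := hM (1 + δ) ⟨by linarith [hδ.1], by linarith [hδ.2]⟩
    simp only [hUV δ hδ.1] at h1
    have hc := wV_cont (hg δ hδ.1)
    rw [intervalIntegral.integral_of_le hlam.le, integral_Ioc_eq_integral_Ioo,
      integral_eq_lintegral_of_nonneg_ae (by filter_upwards with t using abs_nonneg _)
        hc.abs.aestronglyMeasurable]
    apply ENNReal.toReal_le_of_le_ofReal (le_max_right _ _)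
    calc _ ≤ ∫⁻ t in Ioo (-lam) lam, ENNReal.ofReal |wV g δ t| :=
          lintegral_mono_set (Ioo_subset_Ioo_left (by linarith))
      _ ≤ ENNReal.ofReal M := h1
      _ ≤ _ := ENNReal.ofReal_le_ofReal (le_max_left _ _)
  obtain ⟨a, ha⟩ := core_s1 hg hs hf' hlam hM'
  refine ⟨a, ?_, ha⟩
  have hab := abel_part hg ha
  have hshift2 : Tendsto (fun σ : ℝ => σ - 1) (nhdsWithin 1 (Ioi 1)) (nhdsWithin 0 (Ioi 0)) := by
    apply tendsto_nhdsWithin_of_tendsto_nhds_of_eventually_within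
    · have : Continuous (fun σ : ℝ => σ - 1) := by fun_prop
      simpa using (this.tendsto 1).mono_left (nhdsWithin_le_nhds (s := Ioi 1))
    · filter_upwards [self_mem_nhdsWithin] with σ hσ
      have : 1 < σ := hσ
      simpa using this
  refine (hab.comp hshift2).congr' ?_
  filter_upwards [self_mem_nhdsWithin] with σ hσ
  have h1 : 0 < σ - 1 := by have : 1 < σ := hσ; linarith
  have h2 := hUV (σ - 1) h1 0
  rw [add_sub_cancel] at h2
  simp only [Complex.ofReal_zero, zero_mul, add_zero] at h2
  simp only [Function.comp]
  rw [h2, wV]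
  simp
end
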